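/- Soundness of coinductive uniform proofs: if φ is an H^g-formula and Σ; P ⊢co φ is provable in CUP, then ⟦φ⟧ evaluated in the complete Herbrand model M(P) is the true predicate, i.e. ⟦φ⟧_{M(P)} = ⊤. -/

import Mathlib

/-! ## Simple types with a single base type `ι` -/

/-- Simple types over the single base type `ι`. -/
inductive Ty : Type
  | base : Ty
  | arrow : Ty → Ty → Ty

/-- The order of a type: `ord ι = 0`, `ord (σ→τ) = max (ord σ + 1) (ord τ)`. -/
def Ty.order : Ty → ℕ
  | .base => 0
  | .arrow σ τ => max (σ.order + 1) τ.order

/-- The arity of a (first-order) type: `ar ι = 0`, `ar (ι→τ) = ar τ + 1`. -/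
def Ty.arity : Ty → ℕ
  | .base => 0
  | .arrow _ τ => τ.arity + 1

/-- A term signature assigns types to (some) constant names. -/
abbrev Sig : Type := String → Option Ty

/-- A signature is first-order if every symbol has a type of order ≤ 1. -/
def Sig.FirstOrder (Sg : Sig) : Prop := ∀ c τ, Sg c = some τ → τ.order ≤ 1

/-- The arity of a symbol of a (first-order) signature. -/
def Sig.ar (Sg : Sig) (c : String) : ℕ := ((Sg c).map Ty.arity).getD 0

/-! ## Terms (de Bruijn representation) -/

/-- Terms of the simply typed λ-calculus with constants and a fixed point
operator `fix`, in de Bruijn representation. -/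
inductive Tm : Type
  | var : ℕ → Tm
  | const : String → Tm
  | app : Tm → Tm → Tm
  | lam : Ty → Tm → Tm
  | fix : Ty → Tm → Tm

/-- Shift ("weakening") of de Bruijn indices `≥ c` by `d`. -/
def Tm.shift (d : ℕ) : ℕ → Tm → Tm
  | c, .var n => if n < c then .var n else .var (n + d)
  | _, .const f => .const f
  | c, .app M N => .app (Tm.shift d c M) (Tm.shift d c N)
  | c, .lam τ M => .lam τ (Tm.shift d (c + 1) M)
  | c, .fix τ M => .fix τ (Tm.shift d (c + 1) M)

/-- Capture-avoiding substitution `Tm.subst k N M = M[N/k]` of the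
de Bruijn variable `k` by `N` in `M`. -/
def Tm.subst : ℕ → Tm → Tm → Tm
  | k, N, .var n => if n = k then Tm.shift k 0 N else if k < n then .var (n - 1) else .var n
  | _, _, .const f => .const f
  | k, N, .app M₁ M₂ => .app (Tm.subst k N M₁) (Tm.subst k N M₂)
  | k, N, .lam τ M => .lam τ (Tm.subst (k + 1) N M)
  | k, N, .fix τ M => .fix τ (Tm.subst (k + 1) N M)

/-- Typing contexts: lists of types (the head is de Bruijn index 0). -/
abbrev Ctx : Type := List Ty

/-- Typing judgement `Γ ⊢ M : τ` over the signature `Sg`. -/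
inductive HasTy (Sg : Sig) : Ctx → Tm → Ty → Prop
  | var {Γ n τ} : Γ[n]? = some τ → HasTy Sg Γ (.var n) τ
  | const {Γ c τ} : Sg c = some τ → HasTy Sg Γ (.const c) τ
  | app {Γ M N σ τ} : HasTy Sg Γ M (.arrow σ τ) → HasTy Sg Γ N σ → HasTy Sg Γ (.app M N) τ
  | lam {Γ M σ τ} : HasTy Sg (σ :: Γ) M τ → HasTy Sg Γ (.lam σ M) (.arrow σ τ)
  | fixI {Γ M τ} : HasTy Sg (τ :: Γ) M τ → HasTy Sg Γ (.fix τ M) τ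

/-- `lams n M` is the `n`-fold λ-abstraction `λ y₁ … yₙ. M` (all of base type). -/
def lams : ℕ → Tm → Tm
  | 0, M => M
  | n + 1, M => .lam .base (lams n M)

/-- `apps M [N₁, …, Nₙ]` is the iterated application `M N₁ … Nₙ`. -/
def apps : Tm → List Tm → Tm
  | M, [] => M
  | M, N :: Ns => apps (.app M N) Ns

/-- Guarded base terms `Γ ⊢g M : τ`. -/
inductive GBase (Sg : Sig) : Ctx → Tm → Ty → Prop
  | var {Γ n τ} : Γ[n]? = some τ → τ.order ≤ 1 → GBase Sg Γ (.var n) τ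
  | const {Γ c τ} : Sg c = some τ → GBase Sg Γ (.const c) τ
  | app {Γ M N σ τ} : GBase Sg Γ M (.arrow σ τ) → GBase Sg Γ N σ → GBase Sg Γ (.app M N) τ
  | fixI {Γ f σf τ Ms} : Sg f = some σf → τ.order ≤ 1 →
      Ms.length = σf.arity →
      (∀ M ∈ Ms, GBase Sg (List.replicate τ.arity Ty.base ++ τ :: Γ) M .base) →
      GBase Sg Γ (.fix τ (lams τ.arity (apps (.const f) Ms))) τ

/-- Guarded terms: generated from closed guarded base terms, constants and
variables by application and λ-abstraction (equivalently: all `fix`-subterms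
occur inside closed guarded base subterms). -/
inductive Guarded (Sg : Sig) : Tm → Prop
  | base {M τ} : GBase Sg [] M τ → Guarded Sg M
  | const {c} : Guarded Sg (.const c)
  | var {n} : Guarded Sg (.var n)
  | app {M N} : Guarded Sg M → Guarded Sg N → Guarded Sg (.app M N)
  | lam {τ M} : Guarded Sg M → Guarded Sg (.lam τ M)

/-! ## Reduction and conversion -/

/-- One-step β/fix-reduction (compatible closure). -/
inductive Red : Tm → Tm → Prop
  | beta {τ M N} : Red (.app (.lam τ M) N) (Tm.subst 0 N M)
  | fixUnfold {τ M} : Red (.fix τ M) (Tm.subst 0 (.fix τ M) M)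
  | appL {M M' N} : Red M M' → Red (.app M N) (.app M' N)
  | appR {M N N'} : Red N N' → Red (.app M N) (.app M N')
  | lam {τ M M'} : Red M M' → Red (.lam τ M) (.lam τ M')
  | fixC {τ M M'} : Red M M' → Red (.fix τ M) (.fix τ M')

/-- Multi-step reduction `↠`. -/
def RedStar : Tm → Tm → Prop := Relation.ReflTransGen Red

/-- Convertibility: equivalence closure of reduction. -/
def Conv : Tm → Tm → Prop := Relation.EqvGen Red
/-! ## Formulae and the logic iFOLm -/

/-- First-order formulae over λ-terms, with atoms `p M₁ … Mₙ` and the later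
modality `▷` (de Bruijn representation for quantifiers). -/
inductive Fm : Type
  | atom : String → List Tm → Fm
  | top : Fm
  | conj : Fm → Fm → Fm
  | disj : Fm → Fm → Fm
  | impl : Fm → Fm → Fm
  | all : Ty → Fm → Fm
  | ex : Ty → Fm → Fm
  | later : Fm → Fm

/-- Shifting of de Bruijn indices in a formula. -/
def Fm.shift (d : ℕ) : ℕ → Fm → Fm
  | c, .atom p Ms => .atom p (Ms.map (Tm.shift d c))
  | _, .top => .top
  | c, .conj φ ψ => .conj (Fm.shift d c φ) (Fm.shift d c ψ)
  | c, .disj φ ψ => .disj (Fm.shift d c φ) (Fm.shift d c ψ)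
  | c, .impl φ ψ => .impl (Fm.shift d c φ) (Fm.shift d c ψ)
  | c, .all τ φ => .all τ (Fm.shift d (c + 1) φ)
  | c, .ex τ φ => .ex τ (Fm.shift d (c + 1) φ)
  | c, .later φ => .later (Fm.shift d c φ)

/-- Substitution `φ[N/k]` of a term for a de Bruijn variable in a formula. -/
def Fm.subst : ℕ → Tm → Fm → Fm
  | k, N, .atom p Ms => .atom p (Ms.map (Tm.subst k N))
  | _, _, .top => .top
  | k, N, .conj φ ψ => .conj (Fm.subst k N φ) (Fm.subst k N ψ)
  | k, N, .disj φ ψ => .disj (Fm.subst k N φ) (Fm.subst k N ψ)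
  | k, N, .impl φ ψ => .impl (Fm.subst k N φ) (Fm.subst k N ψ)
  | k, N, .all τ φ => .all τ (Fm.subst (k + 1) N φ)
  | k, N, .ex τ φ => .ex τ (Fm.subst (k + 1) N φ)
  | k, N, .later φ => .later (Fm.subst k N φ)

/-- Conversion of formulae: congruence closure of term convertibility. -/
inductive FmConv : Fm → Fm → Prop
  | atom {p Ms Ns} : List.Forall₂ Conv Ms Ns → FmConv (.atom p Ms) (.atom p Ns)
  | top : FmConv .top .top
  | conj {φ φ' ψ ψ'} : FmConv φ φ' → FmConv ψ ψ' → FmConv (.conj φ ψ) (.conj φ' ψ')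
  | disj {φ φ' ψ ψ'} : FmConv φ φ' → FmConv ψ ψ' → FmConv (.disj φ ψ) (.disj φ' ψ')
  | impl {φ φ' ψ ψ'} : FmConv φ φ' → FmConv ψ ψ' → FmConv (.impl φ ψ) (.impl φ' ψ')
  | all {τ φ φ'} : FmConv φ φ' → FmConv (.all τ φ) (.all τ φ')
  | ex {τ φ φ'} : FmConv φ φ' → FmConv (.ex τ φ) (.ex τ φ')
  | later {φ φ'} : FmConv φ φ' → FmConv (.later φ) (.later φ')

/-- The sequent calculus (natural deduction) of the logic `iFOLm`:
intuitionistic first-order logic over guarded terms, extended with the later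
modality `▷` and the rules Next, Mon and Löb.  A sequent `IPrf Sg Γ Δ φ`
corresponds to `Σ; Γ; Δ ⊢ φ`. -/
inductive IPrf (Sg : Sig) : Ctx → Set Fm → Fm → Prop
  | proj {Γ Δ φ} : φ ∈ Δ → IPrf Sg Γ Δ φ
  | conv {Γ Δ φ φ'} : IPrf Sg Γ Δ φ' → FmConv φ φ' → IPrf Sg Γ Δ φ
  | topI {Γ Δ} : IPrf Sg Γ Δ .top
  | andI {Γ Δ φ ψ} : IPrf Sg Γ Δ φ → IPrf Sg Γ Δ ψ → IPrf Sg Γ Δ (.conj φ ψ)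
  | andE1 {Γ Δ φ ψ} : IPrf Sg Γ Δ (.conj φ ψ) → IPrf Sg Γ Δ φ
  | andE2 {Γ Δ φ ψ} : IPrf Sg Γ Δ (.conj φ ψ) → IPrf Sg Γ Δ ψ
  | orI1 {Γ Δ φ ψ} : IPrf Sg Γ Δ φ → IPrf Sg Γ Δ (.disj φ ψ)
  | orI2 {Γ Δ φ ψ} : IPrf Sg Γ Δ ψ → IPrf Sg Γ Δ (.disj φ ψ)
  | orE {Γ Δ φ₁ φ₂ ψ} : IPrf Sg Γ (insert φ₁ Δ) ψ → IPrf Sg Γ (insert φ₂ Δ) ψ →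
      IPrf Sg Γ (insert (.disj φ₁ φ₂) Δ) ψ
  | implI {Γ Δ φ ψ} : IPrf Sg Γ (insert φ Δ) ψ → IPrf Sg Γ Δ (.impl φ ψ)
  | implE {Γ Δ φ ψ} : IPrf Sg Γ Δ (.impl φ ψ) → IPrf Sg Γ Δ φ → IPrf Sg Γ Δ ψ
  | allI {Γ Δ τ φ} : IPrf Sg (τ :: Γ) (Fm.shift 1 0 '' Δ) φ → IPrf Sg Γ Δ (.all τ φ)
  | allE {Γ Δ τ φ M} : IPrf Sg Γ Δ (.all τ φ) → Guarded Sg M → HasTy Sg Γ M τ →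
      IPrf Sg Γ Δ (Fm.subst 0 M φ)
  | exI {Γ Δ τ φ M} : Guarded Sg M → HasTy Sg Γ M τ → IPrf Sg Γ Δ (Fm.subst 0 M φ) →
      IPrf Sg Γ Δ (.ex τ φ)
  | exE {Γ Δ τ φ ψ} :
      IPrf Sg (τ :: Γ) (insert φ (Fm.shift 1 0 '' Δ)) (Fm.shift 1 0 ψ) →
      IPrf Sg Γ (insert (.ex τ φ) Δ) ψ
  | next {Γ Δ φ} : IPrf Sg Γ Δ φ → IPrf Sg Γ Δ (.later φ)
  | mon {Γ Δ φ ψ} : IPrf Sg Γ Δ (.later (.impl φ ψ)) →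
      IPrf Sg Γ Δ (.impl (.later φ) (.later ψ))
  | lob {Γ Δ φ} : IPrf Sg Γ (insert (.later φ) Δ) φ → IPrf Sg Γ Δ φ
/-! ## Coinductive uniform proofs (CUP) -/

/-- Atomic formulae (`⊤` or a predicate applied to terms). -/
def Fm.Atomic : Fm → Prop := fun A => A = .top ∨ ∃ p Ms, A = .atom p Ms

/-- Guarded atoms: atomic formulae all of whose terms are guarded. -/
def GdAtom (Sg : Sig) : Fm → Prop := fun A =>
  A = .top ∨ ∃ p Ms, A = .atom p Ms ∧ ∀ M ∈ Ms, Guarded Sg M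

mutual
/-- Definite clauses (`D`-formulae) of the logic `co-hohh_fix`. -/
inductive IsD (Sg : Sig) : Fm → Prop
  | atom {A} : GdAtom Sg A → IsD Sg A
  | impl {G D} : IsG Sg G → IsD Sg D → IsD Sg (.impl G D)
  | conj {D₁ D₂} : IsD Sg D₁ → IsD Sg D₂ → IsD Sg (.conj D₁ D₂)
  | all {τ D} : IsD Sg D → IsD Sg (.all τ D)

/-- Goal formulae (`G`-formulae) of the logic `co-hohh_fix`. -/
inductive IsG (Sg : Sig) : Fm → Prop
  | atom {A} : GdAtom Sg A → IsG Sg A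
  | conj {G₁ G₂} : IsG Sg G₁ → IsG Sg G₂ → IsG Sg (.conj G₁ G₂)
  | disj {G₁ G₂} : IsG Sg G₁ → IsG Sg G₂ → IsG Sg (.disj G₁ G₂)
  | ex {τ G} : IsG Sg G → IsG Sg (.ex τ G)
  | impl {D G} : IsD Sg D → IsG Sg G → IsG Sg (.impl D G)
  | all {τ G} : IsG Sg G → IsG Sg (.all τ G)
end

mutual
/-- Uniform provability `Σ; P; Δ ⊢ G` (goal-directed proof search);
`P` is the program (plus assumptions added by `→R`), `Δ` the set of
coinduction hypotheses. -/
inductive Uni : Sig → Set Fm → Set Fm → Fm → Prop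
  | decide {Sg P Δ D A} : Fm.Atomic A → D ∈ P ∪ Δ → Foc Sg P Δ D A → Uni Sg P Δ A
  | topR {Sg P Δ} : Uni Sg P Δ .top
  | andR {Sg P Δ G₁ G₂} : Uni Sg P Δ G₁ → Uni Sg P Δ G₂ → Uni Sg P Δ (.conj G₁ G₂)
  | orR1 {Sg P Δ G₁ G₂} : Uni Sg P Δ G₁ → Uni Sg P Δ (.disj G₁ G₂)
  | orR2 {Sg P Δ G₁ G₂} : Uni Sg P Δ G₂ → Uni Sg P Δ (.disj G₁ G₂)
  | implR {Sg P Δ D G} : Uni Sg (insert D P) Δ G → Uni Sg P Δ (.impl D G)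
  | allR {Sg P Δ τ G} (c : String) : Sg c = none →
      Uni (Function.update Sg c (some τ)) P Δ (Fm.subst 0 (.const c) G) →
      Uni Sg P Δ (.all τ G)
  | exR {Sg P Δ τ G N} : GBase Sg [] N τ → Uni Sg P Δ (Fm.subst 0 N G) →
      Uni Sg P Δ (.ex τ G)

/-- Focused (backchaining) provability `Σ; P; Δ; D ⊢ A`. -/
inductive Foc : Sig → Set Fm → Set Fm → Fm → Fm → Prop
  | init {Sg P Δ A A'} : FmConv A A' → Foc Sg P Δ A' A
  | implL {Sg P Δ G D A} : Foc Sg P Δ D A → Uni Sg P Δ G → Foc Sg P Δ (.impl G D) A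
  | andL1 {Sg P Δ D₁ D₂ A} : Foc Sg P Δ D₁ A → Foc Sg P Δ (.conj D₁ D₂) A
  | andL2 {Sg P Δ D₁ D₂ A} : Foc Sg P Δ D₂ A → Foc Sg P Δ (.conj D₁ D₂) A
  | allL {Sg P Δ τ D A N} : GBase Sg [] N τ → Foc Sg P Δ (Fm.subst 0 N D) A →
      Foc Sg P Δ (.all τ D) A
end

/-- Guarded provability `Σ; P; Δ ⊢ ⟨φ⟩`: the guarding modality is decomposed
by `∀R⟨⟩`, `∧R⟨⟩`, `→R⟨⟩` and discharged only by `Decide⟨⟩`, which resolves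
against a clause of the original program `P`. -/
inductive Gua : Sig → Set Fm → Set Fm → Fm → Prop
  | decideG {Sg P Δ D A} : Fm.Atomic A → D ∈ P → Foc Sg P Δ D A → Gua Sg P Δ A
  | allRG {Sg P Δ τ φ} (c : String) : Sg c = none →
      Gua (Function.update Sg c (some τ)) P Δ (Fm.subst 0 (.const c) φ) →
      Gua Sg P Δ (.all τ φ)
  | andRG {Sg P Δ φ₁ φ₂} : Gua Sg P Δ φ₁ → Gua Sg P Δ φ₂ → Gua Sg P Δ (.conj φ₁ φ₂)
  | implRG {Sg P Δ φ₁ φ₂} : Gua Sg P (insert φ₁ Δ) φ₂ → Gua Sg P Δ (.impl φ₁ φ₂)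

/-- Coinductive uniform provability `Σ; P ⊢co φ`: the rule CoFix. -/
def CUP (Sg : Sig) (P : Set Fm) (φ : Fm) : Prop := Gua Sg P {φ} φ

/-! ## Logic programs (sets of Horn clauses) -/

/-- `fix`-freeness of a term. -/
def Tm.NoFix : Tm → Prop
  | .fix _ _ => False
  | .app M N => M.NoFix ∧ N.NoFix
  | .lam _ M => M.NoFix
  | _ => True

/-- Predicate signatures: a predicate name is assigned its list of argument types. -/
abbrev PSig : Type := String → Option (List Ty)

/-- `mkAll n φ = ∀x₁ … ∀xₙ. φ` (all quantifiers over the base type `ι`). -/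
def mkAll : ℕ → Fm → Fm
  | 0, φ => φ
  | n + 1, φ => .all .base (mkAll n φ)

/-- Conjunction of a list of formulae. -/
def mkConj : List Fm → Fm
  | [] => .top
  | [A] => A
  | A :: As => .conj A (mkConj As)

/-- Simple (fix-free) first-order atoms in a context of `n` base-typed variables. -/
def SimpleFOAtom (Sg : Sig) (Pg : PSig) (n : ℕ) (A : Fm) : Prop :=
  ∃ p Ms τs, Pg p = some τs ∧ (∀ τ ∈ τs, τ = Ty.base) ∧ A = .atom p Ms ∧
    List.Forall₂ (fun M τ => Tm.NoFix M ∧ HasTy Sg (List.replicate n .base) M τ) Ms τs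

/-- `H`-formulae (Horn clauses) `∀x⃗. A₁ ∧ … ∧ Aₙ → A₀` with fix-free
first-order atoms. -/
def IsHorn (Sg : Sig) (Pg : PSig) (φ : Fm) : Prop :=
  ∃ n As A₀, (∀ A ∈ As, SimpleFOAtom Sg Pg n A) ∧ SimpleFOAtom Sg Pg n A₀ ∧
    φ = mkAll n (.impl (mkConj As) A₀)

/-- Guarding the body of a clause: place `▷` on each conjunct. -/
def guardConj : Fm → Fm
  | .conj φ ψ => .conj (guardConj φ) (guardConj ψ)
  | .top => .top
  | φ => .later φ

/-- The guarding `⟨φ⟩` of a Horn clause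
`∀x⃗.(A₁ ∧ … ∧ Aₙ) → A₀  ↦  ∀x⃗.(▷A₁ ∧ … ∧ ▷Aₙ) → A₀`. -/
def Fm.guard : Fm → Fm
  | .all τ φ => .all τ (Fm.guard φ)
  | .impl body head => .impl (guardConj body) head
  | φ => φ
/-! ## Coterms and the complete Herbrand base -/

/-- The polynomial functor `X ↦ ⟦Σ⟧(X) + V` of a first-order signature,
with a set `V` of variables. -/
def coSig (Sg : Sig) (V : Type) : PFunctor.{0} where
  A := String ⊕ V
  B := fun a => match a with
    | Sum.inl c => Fin (Sg.ar c)
    | Sum.inr _ => Empty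

/-- Coterms over `Σ` and variables `V`: the final coalgebra (M-type) of
`⟦Σ⟧(-) + V`; `PFunctor.M.dest` is the structure map `root`. -/
def CoTerm (Sg : Sig) (V : Type) : Type := (coSig Sg V).M

/-- Ground coterms: the complete Herbrand universe. -/
abbrev GCoTerm (Sg : Sig) : Type := CoTerm Sg Empty

/-- One step of the substitution coalgebra used to define `csubst`. -/
noncomputable def substStep {Sg : Sig} (θ : ℕ → GCoTerm Sg) :
    (CoTerm Sg ℕ ⊕ GCoTerm Sg) → (coSig Sg Empty).Obj (CoTerm Sg ℕ ⊕ GCoTerm Sg)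
  | Sum.inl t =>
    match PFunctor.M.dest t with
    | ⟨Sum.inl f, k⟩ => ⟨Sum.inl f, fun i => Sum.inl (k i)⟩
    | ⟨Sum.inr v, _⟩ =>
      match PFunctor.M.dest (θ v) with
      | ⟨Sum.inl f, k⟩ => ⟨Sum.inl f, fun i => Sum.inr (k i)⟩
      | ⟨Sum.inr e, _⟩ => e.elim
  | Sum.inr t =>
    match PFunctor.M.dest t with
    | ⟨Sum.inl f, k⟩ => ⟨Sum.inl f, fun i => Sum.inr (k i)⟩
    | ⟨Sum.inr e, _⟩ => e.elim

/-- Substitution of ground coterms for the variables of a coterm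
(the Kleisli structure of the free completely iterative monad). -/
noncomputable def csubst {Sg : Sig} (t : CoTerm Sg ℕ) (θ : ℕ → GCoTerm Sg) : GCoTerm Sg :=
  PFunctor.M.corec (substStep θ) (Sum.inl t)

/-- The complete Herbrand base: atoms `p(t₁, …, tₙ)` over ground coterms. -/
abbrev HBase (Sg : Sig) : Type := String × List (GCoTerm Sg)

/-- A specification of the coterm semantics `⟦-⟧` of (first-order guarded)
terms: it identifies convertible terms and sends a term to the tree determined
by its head normal forms. -/
def SemSpec (Sg : Sig) (sem : Tm → CoTerm Sg ℕ) : Prop :=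
  (∀ M N, Conv M N → sem M = sem N) ∧
  (∀ M f Ns (h : Ns.length = Sg.ar f),
    (∀ N ∈ Ns, Guarded Sg N) →
    RedStar M (apps (.const f) Ns) →
    PFunctor.M.dest (sem M) = ⟨Sum.inl f, fun i => sem (Ns.get (Fin.cast h.symm i))⟩) ∧
  (∀ M x, RedStar M (.var x) →
    PFunctor.M.dest (sem M) = ⟨Sum.inr x, fun e => e.elim⟩)

/-! ## Atoms, Horn clauses and the Herbrand model -/

/-- Syntactic atoms `p M₁ … Mₙ`. -/
structure Atm : Type where
  p : String
  args : List Tm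

/-- The element `⟦A⟧[θ]` of the Herbrand base determined by an atom `A`, the
coterm semantics `sem` of terms and a ground substitution `θ`. -/
noncomputable def Atm.gsem {Sg : Sig} (sem : Tm → CoTerm Sg ℕ) (θ : ℕ → GCoTerm Sg)
    (A : Atm) : HBase Sg :=
  (A.p, A.args.map fun M => csubst (sem M) θ)

/-- A clause `∀x₁ … x_n. A₁ ∧ … ∧ A_q → A₀` (de Bruijn: the variables of the
atoms range over `0, …, n-1`). -/
structure HClause : Type where
  n : ℕ
  body : List Atm
  head : Atm

/-- Well-formedness of a guarded first-order atom in a context of `n`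
base-typed variables. -/
def Atm.WFg (Sg : Sig) (Pg : PSig) (n : ℕ) (A : Atm) : Prop :=
  ∃ τs, Pg A.p = some τs ∧ (∀ τ ∈ τs, τ = Ty.base) ∧
    List.Forall₂ (fun M τ => Guarded Sg M ∧ HasTy Sg (List.replicate n .base) M τ)
      A.args τs

/-- `H^g`-formulae: clauses whose atoms are first-order guarded atoms. -/
def HClause.WFg (Sg : Sig) (Pg : PSig) (C : HClause) : Prop :=
  C.head.WFg Sg Pg C.n ∧ ∀ A ∈ C.body, A.WFg Sg Pg C.n

/-- Well-formedness of a fix-free (simple) first-order atom. -/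
def Atm.WFh (Sg : Sig) (Pg : PSig) (n : ℕ) (A : Atm) : Prop :=
  (∀ M ∈ A.args, Tm.NoFix M) ∧ A.WFg Sg Pg n

/-- `H`-formulae: Horn clauses with fix-free first-order atoms. -/
def HClause.WFh (Sg : Sig) (Pg : PSig) (C : HClause) : Prop :=
  C.head.WFh Sg Pg C.n ∧ ∀ A ∈ C.body, A.WFh Sg Pg C.n

/-- The monotone operator `Φ_P` on interpretations `I ⊆ 𝔅` determined by a
set `P` of clauses. -/
noncomputable def PhiP {Sg : Sig} (P : Set HClause) (sem : Tm → CoTerm Sg ℕ)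
    (I : Set (HBase Sg)) : Set (HBase Sg) :=
  { a | ∃ C ∈ P, ∃ θ : ℕ → GCoTerm Sg,
      a = C.head.gsem sem θ ∧ ∀ B ∈ C.body, B.gsem sem θ ∈ I }

theorem PhiP_mono {Sg : Sig} (P : Set HClause) (sem : Tm → CoTerm Sg ℕ) :
    Monotone (PhiP P sem) := by
  intro I J hIJ a ha
  obtain ⟨C, hC, θ, ha, hb⟩ := ha
  exact ⟨C, hC, θ, ha, fun B hB => hIJ (hb B hB)⟩

/-- The complete Herbrand model `M(P)`: the greatest fixed point of `Φ_P`. -/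
noncomputable def HModel {Sg : Sig} (P : Set HClause) (sem : Tm → CoTerm Sg ℕ) :
    Set (HBase Sg) :=
  OrderHom.gfp ⟨PhiP P sem, PhiP_mono P sem⟩

/-- Extension of an environment by a ground coterm (for a de Bruijn binder). -/
def consEnv {Sg : Sig} (t : GCoTerm Sg) (γ : ℕ → GCoTerm Sg) : ℕ → GCoTerm Sg
  | 0 => t
  | n + 1 => γ n

/-- Interpretation `⟦φ⟧_I` of formulae over a single interpretation
`I ⊆ 𝔅`, as a set of environments. -/
noncomputable def FmSemI {Sg : Sig} (sem : Tm → CoTerm Sg ℕ) (I : Set (HBase Sg)) :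
    Fm → Set (ℕ → GCoTerm Sg)
  | .atom p Ms => {γ | (p, Ms.map fun M => csubst (sem M) γ) ∈ I}
  | .top => Set.univ
  | .conj φ ψ => FmSemI sem I φ ∩ FmSemI sem I ψ
  | .disj φ ψ => FmSemI sem I φ ∪ FmSemI sem I ψ
  | .impl φ ψ => {γ | γ ∈ FmSemI sem I φ → γ ∈ FmSemI sem I ψ}
  | .all _ φ => {γ | ∀ t, consEnv t γ ∈ FmSemI sem I φ}
  | .ex _ φ => {γ | ∃ t, consEnv t γ ∈ FmSemI sem I φ}
  | .later φ => FmSemI sem I φ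

/-- The formula corresponding to an atom. -/
def Atm.toFm (A : Atm) : Fm := .atom A.p A.args

/-- The `H^g`-formula `∀x⃗. A₁ ∧ … ∧ A_q → A₀` corresponding to a clause. -/
def HClause.toFm (C : HClause) : Fm :=
  mkAll C.n (.impl (mkConj (C.body.map Atm.toFm)) C.head.toFm)


/-! ## Renamings and simultaneous substitutions -/

def scons {α : Type} (a : α) (s : ℕ → α) : ℕ → α
  | 0 => a
  | n + 1 => s n

def upr (r : ℕ → ℕ) : ℕ → ℕ := scons 0 (fun n => r n + 1)

def Tm.ren : (ℕ → ℕ) → Tm → Tm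
  | r, .var n => .var (r n)
  | _, .const f => .const f
  | r, .app M N => .app (Tm.ren r M) (Tm.ren r N)
  | r, .lam τ M => .lam τ (Tm.ren (upr r) M)
  | r, .fix τ M => .fix τ (Tm.ren (upr r) M)

def ups (s : ℕ → Tm) : ℕ → Tm := scons (.var 0) (fun n => (s n).ren Nat.succ)

def Tm.sub : (ℕ → Tm) → Tm → Tm
  | s, .var n => s n
  | _, .const f => .const f
  | s, .app M N => .app (Tm.sub s M) (Tm.sub s N)
  | s, .lam τ M => .lam τ (Tm.sub (ups s) M)
  | s, .fix τ M => .fix τ (Tm.sub (ups s) M)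

theorem upr_comp (r r2 : ℕ → ℕ) : (fun n => upr r2 (upr r n)) = upr (fun n => r2 (r n)) := by
  funext n; cases n <;> rfl

theorem Tm.ren_ren (M : Tm) : ∀ (r r2 : ℕ → ℕ), (M.ren r).ren r2 = M.ren (fun n => r2 (r n)) := by
  induction M with
  | var n => intros; rfl
  | const f => intros; rfl
  | app M N ih1 ih2 => intros; simp [Tm.ren, ih1, ih2]
  | lam τ M ih => intros; simp [Tm.ren, ih, upr_comp]
  | fix τ M ih => intros; simp [Tm.ren, ih, upr_comp]

theorem ups_upr (r : ℕ → ℕ) (s : ℕ → Tm) : (fun n => ups s (upr r n)) = ups (fun n => s (r n)) := by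
  funext n; cases n <;> rfl

theorem Tm.sub_ren (M : Tm) : ∀ (r : ℕ → ℕ) (s : ℕ → Tm),
    (M.ren r).sub s = M.sub (fun n => s (r n)) := by
  induction M with
  | var n => intros; rfl
  | const f => intros; rfl
  | app M N ih1 ih2 => intros; simp [Tm.ren, Tm.sub, ih1, ih2]
  | lam τ M ih => intros; simp [Tm.ren, Tm.sub, ih, ups_upr]
  | fix τ M ih => intros; simp [Tm.ren, Tm.sub, ih, ups_upr]

theorem upr_ups (r : ℕ → ℕ) (s : ℕ → Tm) :
    (fun n => (ups s n).ren (upr r)) = ups (fun n => (s n).ren r) := by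
  funext n
  cases n with
  | zero => rfl
  | succ n => simp [ups, scons, Tm.ren_ren, upr]

theorem Tm.ren_sub (M : Tm) : ∀ (s : ℕ → Tm) (r : ℕ → ℕ),
    (M.sub s).ren r = M.sub (fun n => (s n).ren r) := by
  induction M with
  | var n => intros; rfl
  | const f => intros; rfl
  | app M N ih1 ih2 => intros; simp [Tm.ren, Tm.sub, ih1, ih2]
  | lam τ M ih => intros; simp [Tm.ren, Tm.sub, ih, upr_ups]
  | fix τ M ih => intros; simp [Tm.ren, Tm.sub, ih, upr_ups]

theorem ups_ups (s s2 : ℕ → Tm) :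
    (fun n => (ups s n).sub (ups s2)) = ups (fun n => (s n).sub s2) := by
  funext n
  cases n with
  | zero => rfl
  | succ n => simp [ups, scons, Tm.sub_ren, Tm.ren_sub]

theorem Tm.sub_sub (M : Tm) : ∀ (s s2 : ℕ → Tm),
    (M.sub s).sub s2 = M.sub (fun n => (s n).sub s2) := by
  induction M with
  | var n => intros; rfl
  | const f => intros; rfl
  | app M N ih1 ih2 => intros; simp [Tm.sub, ih1, ih2]
  | lam τ M ih => intros; simp [Tm.sub, ih, ups_ups]
  | fix τ M ih => intros; simp [Tm.sub, ih, ups_ups]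

theorem ups_var : ups Tm.var = Tm.var := by
  funext n; cases n <;> rfl

theorem Tm.sub_var (M : Tm) : M.sub Tm.var = M := by
  induction M with
  | var n => rfl
  | const f => rfl
  | app M N ih1 ih2 => simp [Tm.sub, ih1, ih2]
  | lam τ M ih => simp [Tm.sub, ups_var, ih]
  | fix τ M ih => simp [Tm.sub, ups_var, ih]

theorem ups_ren (r : ℕ → ℕ) : ups (fun n => .var (r n)) = fun n => .var (upr r n) := by
  funext n; cases n <;> rfl

theorem Tm.ren_eq_sub (M : Tm) : ∀ (r : ℕ → ℕ), M.ren r = M.sub (fun n => .var (r n)) := by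
  intro r
  have := Tm.ren_sub M Tm.var r
  rw [Tm.sub_var] at this
  exact this

theorem Tm.shift_eq (d : ℕ) (M : Tm) : ∀ c, Tm.shift d c M =
    M.ren (fun n => if n < c then n else n + d) := by
  have hup : ∀ c, upr (fun n => if n < c then n else n + d) =
      (fun n => if n < c + 1 then n else n + d) := by
    intro c; funext n
    cases n with
    | zero => simp [upr, scons]
    | succ n =>
      simp only [upr, scons, Nat.add_lt_add_iff_right]
      split <;> omega
  induction M with
  | var n => intro c; simp only [Tm.shift, Tm.ren]; split <;> rfl
  | const f => intros; rfl
  | app M N ih1 ih2 => intros; simp [Tm.shift, Tm.ren, ih1, ih2]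
  | lam τ M ih => intros; simp [Tm.shift, Tm.ren, ih, hup]
  | fix τ M ih => intros; simp [Tm.shift, Tm.ren, ih, hup]

/-- The simultaneous substitution corresponding to `Tm.subst k N`. -/
def single (k : ℕ) (N : Tm) : ℕ → Tm := fun n =>
  if n = k then N.ren (fun i => i + k) else if k < n then .var (n - 1) else .var n

theorem ups_single (k : ℕ) (N : Tm) : ups (single k N) = single (k + 1) N := by
  funext n
  cases n with
  | zero => simp [ups, scons, single]
  | succ n =>
    simp only [ups, scons, single, Nat.add_right_cancel_iff, Nat.add_lt_add_iff_right]
    split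
    · rw [Tm.ren_ren]; rfl
    · split
      · simp only [Tm.ren]; congr 1; omega
      · rfl

theorem Tm.subst_eq (N M : Tm) : ∀ k, Tm.subst k N M = M.sub (single k N) := by
  induction M with
  | var n =>
    intro k
    simp only [Tm.subst, Tm.sub, single]
    split
    · rw [Tm.shift_eq]; simp
    · rfl
  | const f => intros; rfl
  | app M N ih1 ih2 => intros; simp [Tm.subst, Tm.sub, ih1, ih2]
  | lam τ M ih => intros; simp [Tm.subst, Tm.sub, ih, ups_single]
  | fix τ M ih => intros; simp [Tm.subst, Tm.sub, ih, ups_single]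

theorem single_zero (N : Tm) : single 0 N = scons N Tm.var := by
  funext n
  cases n with
  | zero =>
    simp only [single, scons, if_true]
    rw [Tm.ren_eq_sub]; exact Tm.sub_var N
  | succ n => simp [single, scons]

theorem Tm.subst_zero (N M : Tm) : Tm.subst 0 N M = M.sub (scons N Tm.var) := by
  rw [Tm.subst_eq, single_zero]

theorem ups_scons (s : ℕ → Tm) (N : Tm) :
    (fun n => (ups s n).sub (scons N Tm.var)) = scons N s := by
  funext n
  cases n with
  | zero => rfl
  | succ n =>
    simp only [ups, scons, Tm.sub_ren]
    exact Tm.sub_var _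

theorem Tm.sub_ups_scons (s : ℕ → Tm) (N M : Tm) :
    (M.sub (ups s)).sub (scons N Tm.var) = M.sub (scons N s) := by
  rw [Tm.sub_sub, ups_scons]

theorem scons_sub (N : Tm) (s s2 : ℕ → Tm) :
    (fun n => (scons N s n).sub s2) = scons (N.sub s2) (fun n => (s n).sub s2) := by
  funext n; cases n <;> rfl

theorem Tm.subst_sub (N M : Tm) (s : ℕ → Tm) :
    (Tm.subst 0 N M).sub s = M.sub (scons (N.sub s) s) := by
  rw [Tm.subst_zero, Tm.sub_sub, scons_sub]; rfl

/-! ## Predicates on terms preserved by reduction -/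

def Tm.Cl : ℕ → Tm → Prop
  | k, .var n => n < k
  | _, .const _ => True
  | k, .app M N => M.Cl k ∧ N.Cl k
  | k, .lam _ M => M.Cl (k + 1)
  | k, .fix _ M => M.Cl (k + 1)

def Tm.NoC (c : String) : Tm → Prop
  | .var _ => True
  | .const d => d ≠ c
  | .app M N => M.NoC c ∧ N.NoC c
  | .lam _ M => M.NoC c
  | .fix _ M => M.NoC c

theorem Tm.Cl.sub_congr {M : Tm} : ∀ {k : ℕ} {s s2 : ℕ → Tm}, M.Cl k → (∀ i < k, s i = s2 i) →
    M.sub s = M.sub s2 := by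
  have hu : ∀ {k : ℕ} {s s2 : ℕ → Tm}, (∀ i < k, s i = s2 i) → ∀ i < k + 1, ups s i = ups s2 i := by
    intro k s s2 h i hi
    cases i with
    | zero => rfl
    | succ i => simp [ups, scons, h i (by omega)]
  induction M with
  | var n => intro k s s2 h hs; exact hs n h
  | const f => intros; rfl
  | app M N ih1 ih2 => intro k s s2 h hs; simp [Tm.sub, ih1 h.1 hs, ih2 h.2 hs]
  | lam τ M ih => intro k s s2 h hs; simp [Tm.sub, ih h (hu hs)]
  | fix τ M ih => intro k s s2 h hs; simp [Tm.sub, ih h (hu hs)]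

theorem Tm.Cl.sub_closed {M : Tm} (h : M.Cl 0) (s : ℕ → Tm) : M.sub s = M := by
  rw [h.sub_congr (s2 := Tm.var) (by omega), Tm.sub_var]

theorem Tm.Cl.ren_closed {M : Tm} (h : M.Cl 0) (r : ℕ → ℕ) : M.ren r = M := by
  rw [Tm.ren_eq_sub, h.sub_closed]

theorem Tm.Cl.ren {M : Tm} : ∀ {k l : ℕ} {r : ℕ → ℕ}, M.Cl k → (∀ i < k, r i < l) →
    (M.ren r).Cl l := by
  have hu : ∀ {k l : ℕ} {r : ℕ → ℕ}, (∀ i < k, r i < l) → ∀ i < k + 1, upr r i < l + 1 := by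
    intro k l r h i hi
    cases i with
    | zero => simp [upr, scons]
    | succ i => have := h i (by omega); simp only [upr, scons]; omega
  induction M with
  | var n => intro k l r h hs; exact hs n h
  | const f => intros; trivial
  | app M N ih1 ih2 => intro k l r h hs; exact ⟨ih1 h.1 hs, ih2 h.2 hs⟩
  | lam τ M ih => intro k l r h hs; exact ih (k := k + 1) h (hu hs)
  | fix τ M ih => intro k l r h hs; exact ih (k := k + 1) h (hu hs)

theorem Tm.Cl.sub {M : Tm} : ∀ {k l : ℕ} {s : ℕ → Tm}, M.Cl k → (∀ i < k, (s i).Cl l) →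
    (M.sub s).Cl l := by
  have hu : ∀ {k l : ℕ} {s : ℕ → Tm}, (∀ i < k, (s i).Cl l) → ∀ i < k + 1, (ups s i).Cl (l + 1) := by
    intro k l r h i hi
    cases i with
    | zero => simp [ups, scons, Tm.Cl]
    | succ i => exact (h i (by omega)).ren (by intro i hi; show i + 1 < l + 1; omega)
  induction M with
  | var n => intro k l r h hs; exact hs n h
  | const f => intros; trivial
  | app M N ih1 ih2 => intro k l r h hs; exact ⟨ih1 h.1 hs, ih2 h.2 hs⟩
  | lam τ M ih => intro k l r h hs; exact ih (k := k + 1) h (hu hs)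
  | fix τ M ih => intro k l r h hs; exact ih (k := k + 1) h (hu hs)

theorem Tm.NoC.ren {c : String} {M : Tm} : ∀ {r : ℕ → ℕ}, M.NoC c → (M.ren r).NoC c := by
  induction M with
  | var n => intros; trivial
  | const f => intro r h; exact h
  | app M N ih1 ih2 => intro r h; exact ⟨ih1 h.1, ih2 h.2⟩
  | lam τ M ih => intro r h; exact ih h
  | fix τ M ih => intro r h; exact ih h

theorem Tm.NoC.sub {c : String} {M : Tm} : ∀ {s : ℕ → Tm}, M.NoC c → (∀ i, (s i).NoC c) →
    (M.sub s).NoC c := by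
  have hu : ∀ {s : ℕ → Tm}, (∀ i, (s i).NoC c) → ∀ i, (ups s i).NoC c := by
    intro s h i
    cases i with
    | zero => trivial
    | succ i => exact (h i).ren
  induction M with
  | var n => intro s h hs; exact hs n
  | const f => intro r h hs; exact h
  | app M N ih1 ih2 => intro r h hs; exact ⟨ih1 h.1 hs, ih2 h.2 hs⟩
  | lam τ M ih => intro r h hs; exact ih h (hu hs)
  | fix τ M ih => intro r h hs; exact ih h (hu hs)

theorem Red.cl {M N : Tm} (h : Red M N) : ∀ {k}, M.Cl k → N.Cl k := by
  have key : ∀ {k : ℕ} {M N : Tm}, M.Cl (k + 1) → N.Cl k → (Tm.subst 0 N M).Cl k := by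
    intro k M N hM hN
    rw [Tm.subst_zero]
    refine hM.sub ?_
    intro i hi
    cases i with
    | zero => exact hN
    | succ i => show i < k; omega
  induction h with
  | beta => intro k h; exact key h.1 h.2
  | fixUnfold => intro k h; exact key h h
  | appL _ ih => intro k h; exact ⟨ih h.1, h.2⟩
  | appR _ ih => intro k h; exact ⟨h.1, ih h.2⟩
  | lam _ ih => intro k h; exact ih (k := k + 1) h
  | fixC _ ih => intro k h; exact ih (k := k + 1) h

theorem Red.noC {c : String} {M N : Tm} (h : Red M N) : M.NoC c → N.NoC c := by
  have key : ∀ {M N : Tm}, M.NoC c → N.NoC c → (Tm.subst 0 N M).NoC c := by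
    intro M N hM hN
    rw [Tm.subst_zero]
    refine hM.sub ?_
    intro i
    cases i with
    | zero => exact hN
    | succ i => trivial
  induction h with
  | beta => intro h; exact key h.1 h.2
  | fixUnfold => intro h; exact key h h
  | appL _ ih => intro h; exact ⟨ih h.1, h.2⟩
  | appR _ ih => intro h; exact ⟨h.1, ih h.2⟩
  | lam _ ih => intro h; exact ih h
  | fixC _ ih => intro h; exact ih h

theorem RedStar.cl {M N : Tm} (h : RedStar M N) {k} (hM : M.Cl k) : N.Cl k := by
  induction h with
  | refl => exact hM
  | tail _ h ih => exact h.cl ih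

theorem RedStar.noC {c : String} {M N : Tm} (h : RedStar M N) (hM : M.NoC c) : N.NoC c := by
  induction h with
  | refl => exact hM
  | tail _ h ih => exact h.noC ih

/-! ## Parallel reduction and confluence -/

inductive Par : Tm → Tm → Prop
  | var {n} : Par (.var n) (.var n)
  | const {c} : Par (.const c) (.const c)
  | app {M M' N N'} : Par M M' → Par N N' → Par (.app M N) (.app M' N')
  | lam {τ M M'} : Par M M' → Par (.lam τ M) (.lam τ M')
  | fix {τ M M'} : Par M M' → Par (.fix τ M) (.fix τ M')
  | beta {τ M M' N N'} : Par M M' → Par N N' → Par (.app (.lam τ M) N) (Tm.subst 0 N' M')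
  | unf {τ M M'} : Par M M' → Par (.fix τ M) (Tm.subst 0 (.fix τ M') M')

theorem Par.rfl' (M : Tm) : Par M M := by
  induction M with
  | var n => exact .var
  | const f => exact .const
  | app M N ih1 ih2 => exact .app ih1 ih2
  | lam τ M ih => exact .lam ih
  | fix τ M ih => exact .fix ih

theorem Par.subs {M M' : Tm} (h : Par M M') : ∀ {s s' : ℕ → Tm}, (∀ i, Par (s i) (s' i)) →
    (∀ i r, Par ((s i).ren r) ((s' i).ren r)) → Par (M.sub s) (M'.sub s') := by
  have hu : ∀ {s s' : ℕ → Tm}, (∀ i r, Par ((s i).ren r) ((s' i).ren r)) →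
      ∀ i, Par (ups s i) (ups s' i) := by
    intro s s' h i
    cases i with
    | zero => exact .var
    | succ i => exact h i _
  have hu2 : ∀ {s s' : ℕ → Tm}, (∀ i r, Par ((s i).ren r) ((s' i).ren r)) →
      ∀ i r, Par ((ups s i).ren r) ((ups s' i).ren r) := by
    intro s s' h i r
    cases i with
    | zero => exact .var
    | succ i => simp only [ups, scons, Tm.ren_ren]; exact h i _
  induction h with
  | var => intro s s' h _; exact h _
  | const => intros; exact .const
  | app _ _ ih1 ih2 => intro s s' h h2; exact .app (ih1 h h2) (ih2 h h2)
  | lam _ ih => intro s s' h h2; exact .lam (ih (hu h2) (hu2 h2))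
  | fix _ ih => intro s s' h h2; exact .fix (ih (hu h2) (hu2 h2))
  | beta _ _ ih1 ih2 =>
    intro s s' h h2
    have := Par.beta (τ := by assumption) (ih1 (hu h2) (hu2 h2)) (ih2 h h2)
    rw [Tm.subst_zero, Tm.sub_ups_scons] at this
    rw [Tm.subst_sub]; exact this
  | unf _ ih =>
    intro s s' h h2
    have := Par.unf (τ := by assumption) (ih (hu h2) (hu2 h2))
    rw [Tm.subst_zero, Tm.sub_ups_scons] at this
    rw [Tm.subst_sub]; exact this

theorem Par.ren {M M' : Tm} (h : Par M M') (r : ℕ → ℕ) : Par (M.ren r) (M'.ren r) := by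
  rw [Tm.ren_eq_sub, Tm.ren_eq_sub]
  exact h.subs (fun _ => .var) (fun _ _ => .var)

theorem Par.subst0 {M M' N N' : Tm} (h : Par M M') (h2 : Par N N') :
    Par (Tm.subst 0 N M) (Tm.subst 0 N' M') := by
  rw [Tm.subst_zero, Tm.subst_zero]
  have : ∀ i, Par (scons N Tm.var i) (scons N' Tm.var i) := by
    intro i
    cases i with
    | zero => exact h2
    | succ i => exact .var
  exact h.subs this (fun i r => (this i).ren r)

def Tm.cd : Tm → Tm
  | .var n => .var n
  | .const f => .const f
  | .app (.lam _ M) N => Tm.subst 0 N.cd M.cd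
  | .app M N => .app M.cd N.cd
  | .lam τ M => .lam τ M.cd
  | .fix τ M => Tm.subst 0 (.fix τ M.cd) M.cd

theorem Par.triangle {M N : Tm} (h : Par M N) : Par N M.cd := by
  induction h with
  | var => exact .var
  | const => exact .const
  | lam _ ih => exact .lam ih
  | fix _ ih => exact .unf ih
  | unf _ ih => exact ih.subst0 (.fix ih)
  | beta _ _ ih1 ih2 => exact ih1.subst0 ih2
  | @app M M' N N' h1 h2 ih1 ih2 =>
    cases M with
    | lam τ M =>
      cases h1 with
      | lam h1 =>
        cases ih1 with
        | lam ih1 => exact .beta ih1 ih2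
    | _ => exact .app ih1 ih2

theorem Red.par {M N : Tm} (h : Red M N) : Par M N := by
  induction h with
  | beta => exact .beta (Par.rfl' _) (Par.rfl' _)
  | fixUnfold => exact .unf (Par.rfl' _)
  | appL _ ih => exact .app ih (Par.rfl' _)
  | appR _ ih => exact .app (Par.rfl' _) ih
  | lam _ ih => exact .lam ih
  | fixC _ ih => exact .fix ih

theorem RedStar.app {M M' N N' : Tm} (h : RedStar M M') (h2 : RedStar N N') :
    RedStar (.app M N) (.app M' N') := by
  have a : RedStar (.app M N) (.app M' N) :=
    Relation.ReflTransGen.lift (fun M => Tm.app M N) (fun _ _ h => Red.appL h) _ _ h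
  have b : RedStar (.app M' N) (.app M' N') :=
    Relation.ReflTransGen.lift (fun N => Tm.app M' N) (fun _ _ h => Red.appR h) _ _ h2
  exact a.trans b

theorem RedStar.lam {τ : Ty} {M M' : Tm} (h : RedStar M M') :
    RedStar (.lam τ M) (.lam τ M') :=
  Relation.ReflTransGen.lift (fun M => Tm.lam τ M) (fun _ _ h => Red.lam h) _ _ h

theorem RedStar.fix {τ : Ty} {M M' : Tm} (h : RedStar M M') :
    RedStar (.fix τ M) (.fix τ M') :=
  Relation.ReflTransGen.lift (fun M => Tm.fix τ M) (fun _ _ h => Red.fixC h) _ _ h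

theorem Par.redStar {M N : Tm} (h : Par M N) : RedStar M N := by
  induction h with
  | var => exact .refl
  | const => exact .refl
  | app _ _ ih1 ih2 => exact ih1.app ih2
  | lam _ ih => exact ih.lam
  | fix _ ih => exact ih.fix
  | beta _ _ ih1 ih2 => exact (ih1.lam.app ih2).tail .beta
  | unf _ ih => exact ih.fix.tail .fixUnfold

theorem redStar_iff {M N : Tm} : RedStar M N ↔ Relation.ReflTransGen Par M N := by
  constructor
  · exact Relation.ReflTransGen.mono (fun _ _ h => Red.par h) _ _
  · intro h
    induction h with
    | refl => exact .refl
    | tail _ h ih => exact ih.trans h.redStar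

theorem confluence {M N L : Tm} (h : RedStar M N) (h2 : RedStar M L) :
    ∃ K, RedStar N K ∧ RedStar L K := by
  rw [redStar_iff] at h h2
  obtain ⟨K, hK1, hK2⟩ := Relation.church_rosser (r := Par)
    (fun a b c hb hc => ⟨a.cd, .single hb.triangle, .single hc.triangle⟩) h h2
  exact ⟨K, redStar_iff.2 hK1, redStar_iff.2 hK2⟩

theorem Conv.join {M N : Tm} (h : Conv M N) : ∃ K, RedStar M K ∧ RedStar N K := by
  induction h with
  | rel _ _ h => exact ⟨_, .single h, .refl⟩
  | refl => exact ⟨_, .refl, .refl⟩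
  | symm _ _ _ ih => obtain ⟨K, a, b⟩ := ih; exact ⟨K, b, a⟩
  | trans _ _ _ _ _ ih1 ih2 =>
    obtain ⟨K, a, b⟩ := ih1
    obtain ⟨K2, c, d⟩ := ih2
    obtain ⟨K3, e, f⟩ := confluence b c
    exact ⟨K3, a.trans e, d.trans f⟩

theorem RedStar.conv {M N : Tm} (h : RedStar M N) : Conv M N := by
  induction h with
  | refl => exact .refl _
  | tail _ h ih => exact .trans _ _ _ ih (.rel _ _ h)

theorem Conv.rfl' (M : Tm) : Conv M M := .refl _
theorem Conv.sym {M N : Tm} (h : Conv M N) : Conv N M := .symm _ _ h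
theorem Conv.tr {M N L : Tm} (h : Conv M N) (h2 : Conv N L) : Conv M L := .trans _ _ _ h h2

theorem Red.sub {M N : Tm} (h : Red M N) : ∀ (s : ℕ → Tm), Red (M.sub s) (N.sub s) := by
  induction h with
  | @beta τ M N =>
    intro s
    have := @Red.beta τ (M.sub (ups s)) (N.sub s)
    rw [Tm.subst_zero, Tm.sub_ups_scons] at this
    rw [Tm.subst_sub]; exact this
  | @fixUnfold τ M =>
    intro s
    have := @Red.fixUnfold τ (M.sub (ups s))
    rw [Tm.subst_zero, Tm.sub_ups_scons] at this
    rw [Tm.subst_sub]; exact this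
  | appL _ ih => intro s; exact .appL (ih s)
  | appR _ ih => intro s; exact .appR (ih s)
  | lam _ ih => intro s; exact .lam (ih _)
  | fixC _ ih => intro s; exact .fixC (ih _)

theorem Conv.sub {M N : Tm} (h : Conv M N) (s : ℕ → Tm) : Conv (M.sub s) (N.sub s) := by
  induction h with
  | rel _ _ h => exact .rel _ _ (h.sub s)
  | refl => exact .refl _
  | symm _ _ _ ih => exact ih.sym
  | trans _ _ _ _ _ ih1 ih2 => exact ih1.tr ih2

theorem Conv.appL {M N : Tm} (h : Conv M N) (L : Tm) : Conv (.app M L) (.app N L) := by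
  induction h with
  | rel _ _ h => exact .rel _ _ (.appL h)
  | refl => exact .refl _
  | symm _ _ _ ih => exact ih.sym
  | trans _ _ _ _ _ ih1 ih2 => exact ih1.tr ih2

theorem Conv.appR {M N : Tm} (h : Conv M N) (L : Tm) : Conv (.app L M) (.app L N) := by
  induction h with
  | rel _ _ h => exact .rel _ _ (.appR h)
  | refl => exact .refl _
  | symm _ _ _ ih => exact ih.sym
  | trans _ _ _ _ _ ih1 ih2 => exact ih1.tr ih2

theorem Conv.apps {Ns Ns' : List Tm} (h : List.Forall₂ Conv Ns Ns') : ∀ {M M' : Tm}, Conv M M' →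
    Conv (apps M Ns) (apps M' Ns') := by
  induction h with
  | nil => intro M M' h; exact h
  | cons h1 _ ih => intro M M' h; exact ih ((h.appL _).tr (h1.appR _))

theorem Conv.appsL (Ns : List Tm) {M M' : Tm} (h : Conv M M') :
    Conv (_root_.apps M Ns) (_root_.apps M' Ns) :=
  Conv.apps (List.forall₂_same.2 fun _ _ => Conv.rfl' _) h

/-! ### Constant-headed terms -/

theorem forall2_trans {α : Type} {R : α → α → Prop} (hR : ∀ a b c, R a b → R b c → R a c)
    {l1 l2 : List α} (h : List.Forall₂ R l1 l2) : ∀ {l3}, List.Forall₂ R l2 l3 →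
    List.Forall₂ R l1 l3 := by
  induction h with
  | nil => intro l3 h; exact h
  | cons h1 _ ih =>
    intro l3 h
    cases h with
    | cons h2 h3 => exact .cons (hR _ _ _ h1 h2) (ih h3)

theorem apps_append (M : Tm) (Ns Ls : List Tm) : apps M (Ns ++ Ls) = apps (apps M Ns) Ls := by
  induction Ns generalizing M with
  | nil => rfl
  | cons N Ns ih => exact ih _

theorem red_apps_const {f : String} {Ns : List Tm} : ∀ {K : Tm}, Red (apps (.const f) Ns) K →
    ∃ Ns', K = apps (.const f) Ns' ∧ List.Forall₂ RedStar Ns Ns' := by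
  induction Ns using List.reverseRecOn with
  | nil => intro K h; cases h
  | append_singleton Ns N ih =>
    intro K h
    rw [apps_append] at h
    simp only [apps] at h
    generalize hM : apps (.const f) Ns = M at h ih
    cases h with
    | beta =>
      exfalso
      rcases List.eq_nil_or_concat' Ns with rfl | ⟨L, b, rfl⟩
      · cases hM
      · rw [apps_append] at hM; cases hM
    | appL h =>
      obtain ⟨Ns', rfl, h2⟩ := ih h
      exact ⟨Ns' ++ [N], by rw [apps_append]; rfl, List.rel_append h2 (.cons .refl .nil)⟩
    | @appR _ _ N' h =>
      refine ⟨Ns ++ [N'], by rw [apps_append, hM]; rfl,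
        List.rel_append (List.forall₂_same.2 fun _ _ => .refl) (.cons (.single h) .nil)⟩

theorem redStar_apps_const {f : String} {Ns : List Tm} {K : Tm}
    (h : RedStar (apps (.const f) Ns) K) :
    ∃ Ns', K = apps (.const f) Ns' ∧ List.Forall₂ RedStar Ns Ns' := by
  induction h with
  | refl => exact ⟨Ns, rfl, List.forall₂_same.2 fun _ _ => .refl⟩
  | tail _ h ih =>
    obtain ⟨Ns', rfl, h2⟩ := ih
    obtain ⟨Ns2, rfl, h3⟩ := red_apps_const h
    exact ⟨Ns2, rfl, forall2_trans (fun _ _ _ a b => a.trans b) h2 h3⟩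

theorem redStar_var {x : ℕ} {K : Tm} (h : RedStar (.var x) K) : K = .var x := by
  induction h with
  | refl => rfl
  | tail _ h ih => subst ih; cases h

theorem apps_const_inj {f g : String} {Ns : List Tm} : ∀ {Ms : List Tm},
    apps (.const f) Ns = apps (.const g) Ms → f = g ∧ Ns = Ms := by
  induction Ns using List.reverseRecOn with
  | nil =>
    intro Ms h
    rcases List.eq_nil_or_concat' Ms with rfl | ⟨L, b, rfl⟩
    · cases h; exact ⟨rfl, rfl⟩
    · rw [apps_append] at h; cases h
  | append_singleton Ns N ih =>
    intro Ms h
    rw [apps_append] at h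
    rcases List.eq_nil_or_concat' Ms with rfl | ⟨L, b, rfl⟩
    · cases h
    · rw [apps_append] at h
      simp only [apps, Tm.app.injEq] at h
      obtain ⟨h1, rfl⟩ := ih h.1
      exact ⟨h1, by rw [h.2]⟩

theorem apps_const_ne_var {f : String} {Ns : List Tm} {x : ℕ} : apps (.const f) Ns ≠ .var x := by
  intro h
  rcases List.eq_nil_or_concat' Ns with rfl | ⟨L, b, rfl⟩
  · cases h
  · rw [apps_append] at h; cases h

theorem conv_hn {M M' : Tm} {f : String} {Ns : List Tm} (h : Conv M M')
    (hM : Conv M (apps (.const f) Ns)) :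
    ∃ Ns', RedStar M' (apps (.const f) Ns') ∧ List.Forall₂ Conv Ns Ns' := by
  obtain ⟨K, a, b⟩ := (h.sym.tr hM).join
  obtain ⟨Ns', rfl, h2⟩ := redStar_apps_const b
  exact ⟨Ns', a, h2.imp fun _ _ h => RedStar.conv h⟩

theorem conv_var {M M' : Tm} {x : ℕ} (h : Conv M M') (hM : Conv M (.var x)) :
    RedStar M' (.var x) := by
  obtain ⟨K, a, b⟩ := (h.sym.tr hM).join
  have := redStar_var b
  subst this; exact a

theorem conv_apps_inj {f g : String} {Ns Ms : List Tm}
    (h : Conv (apps (.const f) Ns) (apps (.const g) Ms)) : f = g ∧ List.Forall₂ Conv Ns Ms := by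
  obtain ⟨Ns', h1, h2⟩ := conv_hn h (Conv.rfl' _)
  obtain ⟨Ms', h3, h4⟩ := redStar_apps_const h1
  obtain ⟨rfl, rfl⟩ := apps_const_inj h3
  refine ⟨rfl, forall2_trans (R := Conv) (fun _ _ _ a b => Conv.tr a b) h2 ?_⟩
  exact (h4.imp fun _ _ h => (RedStar.conv h).sym).flip.imp fun _ _ h => h

theorem conv_apps_var {f : String} {Ns : List Tm} {x : ℕ}
    (h : Conv (apps (.const f) Ns) (.var x)) : False := by
  have := conv_var h h
  have := conv_var (Conv.rfl' _) h
  obtain ⟨Ms', h3, h4⟩ := redStar_apps_const this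
  exact apps_const_ne_var h3.symm

theorem conv_var_var {x y : ℕ} (h : Conv (.var x) (.var y)) : x = y := by
  have := redStar_var (conv_var (Conv.rfl' _) h)
  cases this; rfl

/-! ## Valuation of untyped terms as ground coterms -/

section Valuation

variable {Sg : Sig}

/-- Some ground coterm (an infinite tree with constant labels). -/
noncomputable def botTree (Sg : Sig) : GCoTerm Sg :=
  PFunctor.M.corec (F := coSig Sg Empty) (X := Unit) (fun u => ⟨Sum.inl default, fun _ => u⟩) ()

theorem gco_dest (t : GCoTerm Sg) : ∃ f k, PFunctor.M.dest t = ⟨Sum.inl f, k⟩ := by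
  rcases h : PFunctor.M.dest t with ⟨a, k⟩
  rcases a with f | e
  · exact ⟨f, k, rfl⟩
  · exact e.elim

theorem gco_coind (Q : GCoTerm Sg → GCoTerm Sg → Prop)
    (h : ∀ x y, Q x y → x = y ∨ ∃ f k k', PFunctor.M.dest x = ⟨Sum.inl f, k⟩ ∧
      PFunctor.M.dest y = ⟨Sum.inl f, k'⟩ ∧ ∀ i, Q (k i) (k' i)) :
    ∀ x y, Q x y → x = y := by
  intro x y hxy
  refine PFunctor.M.bisim (P := coSig Sg Empty) (fun x y => x = y ∨ Q x y) ?_ x y (Or.inr hxy)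
  rintro x y (rfl | hq)
  · obtain ⟨f, k, hk⟩ := gco_dest x
    exact ⟨_, k, k, hk, hk, fun i => Or.inl rfl⟩
  · rcases h x y hq with rfl | ⟨f, k, k', h1, h2, h3⟩
    · obtain ⟨f, k, hk⟩ := gco_dest x
      exact ⟨_, k, k, hk, hk, fun i => Or.inl rfl⟩
    · exact ⟨_, k, k', h1, h2, fun i => Or.inr (h3 i)⟩

/-- `M` has a constant-headed normal form to be evaluated structurally. -/
def Prod1 (Sg : Sig) (ρ : String → Option (GCoTerm Sg)) (M : Tm) : Prop :=
  ∃ q : String × List Tm, RedStar M (apps (.const q.1) q.2) ∧ ρ q.1 = none ∧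
    q.2.length = Sg.ar q.1

open Classical in
noncomputable def atomVal (ρ : String → Option (GCoTerm Sg)) (γ : ℕ → GCoTerm Sg) (M : Tm) :
    GCoTerm Sg :=
  if h : ∃ t f Ns, RedStar M (apps (.const f) Ns) ∧ ρ f = some t then h.choose
  else if h : ∃ x, RedStar M (.var x) then γ h.choose
  else botTree Sg

open Classical in
noncomputable def valStep (ρ : String → Option (GCoTerm Sg)) (γ : ℕ → GCoTerm Sg) :
    (Tm ⊕ GCoTerm Sg) → (coSig Sg Empty).Obj (Tm ⊕ GCoTerm Sg)
  | Sum.inl M =>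
    if h : Prod1 Sg ρ M then
      ⟨Sum.inl h.choose.1, fun i => Sum.inl (h.choose.2.get (Fin.cast h.choose_spec.2.2.symm i))⟩
    else (coSig Sg Empty).map Sum.inr (PFunctor.M.dest (atomVal ρ γ M))
  | Sum.inr t => (coSig Sg Empty).map Sum.inr (PFunctor.M.dest t)

noncomputable def val (ρ : String → Option (GCoTerm Sg)) (γ : ℕ → GCoTerm Sg) (M : Tm) :
    GCoTerm Sg := PFunctor.M.corec (valStep ρ γ) (Sum.inl M)

variable {ρ : String → Option (GCoTerm Sg)} {γ : ℕ → GCoTerm Sg}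

theorem valStep_inr (t : GCoTerm Sg) : PFunctor.M.corec (valStep ρ γ) (Sum.inr t) = t := by
  refine gco_coind (fun x y => x = PFunctor.M.corec (valStep ρ γ) (Sum.inr y)) ?_ _ _ rfl
  rintro x y rfl
  right
  obtain ⟨f, k, hk⟩ := gco_dest y
  refine ⟨f, fun i => PFunctor.M.corec (valStep ρ γ) (Sum.inr (k i)), k, ?_, hk, fun i => rfl⟩
  rw [PFunctor.M.dest_corec]
  simp only [valStep, hk]
  rfl

theorem valStep_pos {M : Tm} (h : Prod1 Sg ρ M) : valStep ρ γ (Sum.inl M) =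
    ⟨Sum.inl h.choose.1, fun i => Sum.inl (h.choose.2.get
      (Fin.cast h.choose_spec.2.2.symm i))⟩ := dif_pos h

theorem valStep_neg {M : Tm} (h : ¬ Prod1 Sg ρ M) : valStep ρ γ (Sum.inl M) =
    (coSig Sg Empty).map Sum.inr (PFunctor.M.dest (atomVal ρ γ M)) := dif_neg h

theorem val_atom {M : Tm} (h : ¬ Prod1 Sg ρ M) : val ρ γ M = atomVal ρ γ M := by
  refine gco_coind (fun x y => (x = val ρ γ M ∧ y = atomVal ρ γ M) ∨ x = y) ?_ _ _
    (Or.inl ⟨rfl, rfl⟩)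
  rintro x y (⟨rfl, rfl⟩ | rfl)
  · right
    obtain ⟨f, k, hk⟩ := gco_dest (atomVal ρ γ M)
    refine ⟨f, k, k, ?_, hk, fun i => Or.inr rfl⟩
    rw [val, PFunctor.M.dest_corec, valStep_neg h, hk]
    exact congrArg (Sigma.mk (β := fun a => (coSig Sg Empty).B a → GCoTerm Sg) (Sum.inl f))
      (funext fun i => valStep_inr (ρ := ρ) (γ := γ) (k i))
  · left; rfl

theorem val_prod_raw {M : Tm} (hp : Prod1 Sg ρ M) : ∃ f Ns, ∃ h : Ns.length = Sg.ar f,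
    RedStar M (apps (.const f) Ns) ∧ ρ f = none ∧
    PFunctor.M.dest (val ρ γ M) =
      ⟨Sum.inl f, fun i => val ρ γ (Ns.get (Fin.cast h.symm i))⟩ := by
  refine ⟨hp.choose.1, hp.choose.2, hp.choose_spec.2.2, hp.choose_spec.1, hp.choose_spec.2.1, ?_⟩
  rw [val, PFunctor.M.dest_corec, valStep_pos hp]
  rfl

theorem prod1_conv {M N : Tm} (h : Conv M N) (hp : Prod1 Sg ρ M) : Prod1 Sg ρ N := by
  obtain ⟨⟨f, Ns⟩, h1, h2, h3⟩ := hp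
  obtain ⟨Ns', h4, h5⟩ := conv_hn h h1.conv
  exact ⟨⟨f, Ns'⟩, h4, h2, by rw [← h3]; exact h5.length_eq.symm⟩

theorem atomVal_const {M : Tm} {f Ns t} (h : Conv M (apps (.const f) Ns)) (hf : ρ f = some t) :
    atomVal ρ γ M = t := by
  obtain ⟨Ns', h1, _⟩ := conv_hn (Conv.rfl' M) h
  have hex : ∃ t f Ns, RedStar M (apps (.const f) Ns) ∧ ρ f = some t := ⟨t, f, Ns', h1, hf⟩
  rw [atomVal, dif_pos hex]
  obtain ⟨g, Ms, h2, h3⟩ := hex.choose_spec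
  obtain ⟨rfl, _⟩ := conv_apps_inj (h2.conv.sym.tr h)
  rw [hf] at h3
  exact (Option.some.inj h3).symm

theorem atomVal_var {M : Tm} {x} (h : Conv M (.var x)) : atomVal ρ γ M = γ x := by
  have hn : ¬ ∃ t f Ns, RedStar M (apps (.const f) Ns) ∧ ρ f = some t := by
    rintro ⟨t, f, Ns, h1, _⟩
    exact conv_apps_var (h1.conv.sym.tr h)
  have hx : ∃ x, RedStar M (.var x) := ⟨x, conv_var (Conv.rfl' M) h⟩
  rw [atomVal, dif_neg hn, dif_pos hx]
  rw [conv_var_var (hx.choose_spec.conv.sym.tr h)]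

theorem not_prod1_var {M : Tm} {x} (h : Conv M (.var x)) : ¬ Prod1 Sg ρ M := by
  rintro ⟨⟨f, Ns⟩, h1, _⟩
  exact conv_apps_var (h1.conv.sym.tr h)

theorem not_prod1_const {M : Tm} {f Ns t} (h : Conv M (apps (.const f) Ns)) (hf : ρ f = some t) :
    ¬ Prod1 Sg ρ M := by
  rintro ⟨⟨g, Ns⟩, h1, h2, _⟩
  obtain ⟨rfl, _⟩ := conv_apps_inj (h1.conv.sym.tr h)
  simp [hf] at h2

theorem val_var {M : Tm} {x} (h : Conv M (.var x)) : val ρ γ M = γ x := by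
  rw [val_atom (not_prod1_var h), atomVal_var h]

theorem val_const {M : Tm} {f Ns t} (h : Conv M (apps (.const f) Ns)) (hf : ρ f = some t) :
    val ρ γ M = t := by
  rw [val_atom (not_prod1_const h hf), atomVal_const h hf]

/-- The stuck case. -/
theorem val_stuck {M : Tm} (h1 : ¬ Prod1 Sg ρ M)
    (h2 : ¬ ∃ t f Ns, RedStar M (apps (.const f) Ns) ∧ ρ f = some t)
    (h3 : ¬ ∃ x, RedStar M (.var x)) : val ρ γ M = botTree Sg := by
  rw [val_atom h1, atomVal, dif_neg h2, dif_neg h3]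

theorem val_conv {M N : Tm} (h : Conv M N) : val ρ γ M = val ρ γ N := by
  refine gco_coind (fun x y => ∃ M N, Conv M N ∧ x = val ρ γ M ∧ y = val ρ γ N) ?_ _ _
    ⟨M, N, h, rfl, rfl⟩
  clear h M N
  rintro x y ⟨M, N, h, rfl, rfl⟩
  by_cases hp : Prod1 Sg ρ M
  · right
    obtain ⟨f, Ns, hl, h1, h2, h3⟩ := val_prod_raw (γ := γ) hp
    obtain ⟨g, Ms, hm, h4, h5, h6⟩ := val_prod_raw (γ := γ) (prod1_conv h hp)
    obtain ⟨rfl, h7⟩ := conv_apps_inj ((h1.conv.sym.tr h).tr h4.conv)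
    refine ⟨f, _, _, h3, h6, fun i => ⟨_, _, ?_, rfl, rfl⟩⟩
    exact h7.get _ _
  · left
    have hp2 : ¬ Prod1 Sg ρ N := fun h' => hp (prod1_conv h.sym h')
    by_cases hc : ∃ t f Ns, RedStar M (apps (.const f) Ns) ∧ ρ f = some t
    · obtain ⟨t, f, Ns, h1, h2⟩ := hc
      rw [val_const h1.conv h2, val_const (h.sym.tr h1.conv) h2]
    by_cases hx : ∃ x, RedStar M (.var x)
    · obtain ⟨x, h1⟩ := hx
      rw [val_var h1.conv, val_var (h.sym.tr h1.conv)]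
    rw [val_stuck hp hc hx, val_stuck hp2]
    · rintro ⟨t, f, Ns, h1, h2⟩
      obtain ⟨Ns', h3, _⟩ := conv_hn h.sym h1.conv
      exact hc ⟨t, f, Ns', h3, h2⟩
    · rintro ⟨x, h1⟩
      exact hx ⟨x, conv_var h.sym h1.conv⟩

theorem val_prod {M : Tm} {f Ns} (h : Conv M (apps (.const f) Ns)) (hf : ρ f = none)
    (hl : Ns.length = Sg.ar f) : PFunctor.M.dest (val ρ γ M) =
      ⟨Sum.inl f, fun i => val ρ γ (Ns.get (Fin.cast hl.symm i))⟩ := by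
  have hp : Prod1 Sg ρ M := by
    obtain ⟨Ns', h1, h2⟩ := conv_hn (Conv.rfl' M) h
    exact ⟨⟨f, Ns'⟩, h1, hf, by rw [← hl]; exact h2.length_eq.symm⟩
  obtain ⟨g, Ms, hm, h4, h5, h6⟩ := val_prod_raw (γ := γ) hp
  obtain ⟨rfl, h7⟩ := conv_apps_inj (h4.conv.sym.tr h)
  rw [h6]
  congr 1
  funext i
  exact val_conv (h7.get _ _)

theorem cl_apps {k : ℕ} {Ns : List Tm} : ∀ {M : Tm}, (apps M Ns).Cl k →
    M.Cl k ∧ ∀ N ∈ Ns, N.Cl k := by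
  induction Ns with
  | nil => intro M h; exact ⟨h, by simp⟩
  | cons N Ns ih =>
    intro M h
    obtain ⟨⟨h1, h2⟩, h3⟩ := ih h
    exact ⟨h1, by simpa using ⟨h2, h3⟩⟩

theorem noC_apps {c : String} {Ns : List Tm} : ∀ {M : Tm}, (apps M Ns).NoC c →
    M.NoC c ∧ ∀ N ∈ Ns, N.NoC c := by
  induction Ns with
  | nil => intro M h; exact ⟨h, by simp⟩
  | cons N Ns ih =>
    intro M h
    obtain ⟨⟨h1, h2⟩, h3⟩ := ih h
    exact ⟨h1, by simpa using ⟨h2, h3⟩⟩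

/-- Values of terms depend only on the relevant part of the environment. -/
theorem val_congr {ρ' : String → Option (GCoTerm Sg)} {γ' : ℕ → GCoTerm Sg} {k : ℕ}
    (hγ : ∀ i, i < k → γ i = γ' i) {M : Tm} (hM : M.Cl k)
    (hc : ∀ c, M.NoC c ∨ ρ c = ρ' c) : val ρ γ M = val ρ' γ' M := by
  refine gco_coind (fun x y => ∃ M : Tm, M.Cl k ∧ (∀ c, M.NoC c ∨ ρ c = ρ' c) ∧
    x = val ρ γ M ∧ y = val ρ' γ' M) ?_ _ _ ⟨M, hM, hc, rfl, rfl⟩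
  clear hM hc M
  rintro x y ⟨M, hM, hc, rfl, rfl⟩
  have hρ : ∀ {f Ns}, RedStar M (apps (.const f) Ns) → ρ f = ρ' f := by
    intro f Ns h
    rcases hc f with h1 | h1
    · exact absurd rfl (noC_apps (h.noC h1)).1
    · exact h1
  by_cases hp : Prod1 Sg ρ M
  · right
    obtain ⟨⟨f, Ns⟩, h1, h2, h3⟩ := hp
    refine ⟨f, _, _, val_prod h1.conv h2 h3, val_prod h1.conv ((hρ h1).symm.trans h2) h3,
      fun i => ⟨_, ?_, ?_, rfl, rfl⟩⟩
    · exact (cl_apps (h1.cl hM)).2 _ (List.get_mem _ _)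
    · intro c
      rcases hc c with h | h
      · exact Or.inl ((noC_apps (h1.noC h)).2 _ (List.get_mem _ _))
      · exact Or.inr h
  · left
    have hp2 : ¬ Prod1 Sg ρ' M := by
      rintro ⟨⟨f, Ns⟩, h1, h2, h3⟩
      exact hp ⟨⟨f, Ns⟩, h1, (hρ h1).trans h2, h3⟩
    by_cases hc : ∃ t f Ns, RedStar M (apps (.const f) Ns) ∧ ρ f = some t
    · obtain ⟨t, f, Ns, h1, h2⟩ := hc
      rw [val_const h1.conv h2, val_const h1.conv ((hρ h1).symm.trans h2)]
    by_cases hx : ∃ x, RedStar M (.var x)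
    · obtain ⟨x, h1⟩ := hx
      rw [val_var h1.conv, val_var h1.conv]
      exact hγ x (h1.cl hM)
    rw [val_stuck hp hc hx, val_stuck hp2 _ hx]
    rintro ⟨t, f, Ns, h1, h2⟩
    exact hc ⟨t, f, Ns, h1, (hρ h1).trans h2⟩

theorem Tm.exists_cl (M : Tm) : ∃ k, M.Cl k := by
  have mono : ∀ (M : Tm) {k l : ℕ}, k ≤ l → M.Cl k → M.Cl l := by
    intro M
    induction M with
    | var n => intro k l h h2; exact lt_of_lt_of_le h2 h
    | const f => intros; trivial
    | app M N ih1 ih2 => intro k l h h2; exact ⟨ih1 h h2.1, ih2 h h2.2⟩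
    | lam τ M ih => intro k l h h2; exact ih (by omega : k + 1 ≤ l + 1) h2
    | fix τ M ih => intro k l h h2; exact ih (by omega : k + 1 ≤ l + 1) h2
  induction M with
  | var n => exact ⟨n + 1, Nat.lt_succ_self n⟩
  | const f => exact ⟨0, trivial⟩
  | app M N ih1 ih2 =>
    obtain ⟨k, hk⟩ := ih1
    obtain ⟨l, hl⟩ := ih2
    exact ⟨max k l, mono _ (le_max_left _ _) hk, mono _ (le_max_right _ _) hl⟩
  | lam τ M ih => obtain ⟨k, hk⟩ := ih; exact ⟨k, mono M (Nat.le_succ k) hk⟩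
  | fix τ M ih => obtain ⟨k, hk⟩ := ih; exact ⟨k, mono M (Nat.le_succ k) hk⟩

theorem val_congr_const {ρ' : String → Option (GCoTerm Sg)} {M : Tm}
    (hc : ∀ c, M.NoC c ∨ ρ c = ρ' c) : val ρ γ M = val ρ' γ M := by
  obtain ⟨k, hk⟩ := M.exists_cl
  exact val_congr (fun _ _ => rfl) hk hc

theorem val_closed {γ' : ℕ → GCoTerm Sg} {M : Tm} (hM : M.Cl 0) : val ρ γ M = val ρ γ' M :=
  val_congr (k := 0) (by omega) hM (fun _ => Or.inr rfl)

/-! ## Productive terms -/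

/-- One productive step into the set `S`. -/
def OKStep (Sg : Sig) (S : Tm → Prop) (M : Tm) : Prop :=
  (∃ f Ns, Conv M (apps (.const f) Ns) ∧ Ns.length = Sg.ar f ∧ ∀ N ∈ Ns, S N) ∨
  (∃ x, Conv M (.var x)) ∨ (∃ N, Conv M N ∧ N.Cl 0)

def OK (Sg : Sig) (M : Tm) : Prop := ∃ S : Tm → Prop, S M ∧ ∀ M, S M → OKStep Sg S M

theorem OK.step {M : Tm} (h : OK Sg M) : OKStep Sg (OK Sg) M := by
  obtain ⟨S, hM, hS⟩ := h
  rcases hS M hM with ⟨f, Ns, h1, h2, h3⟩ | h | h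
  · exact Or.inl ⟨f, Ns, h1, h2, fun N hN => ⟨S, h3 N hN, hS⟩⟩
  · exact Or.inr (Or.inl h)
  · exact Or.inr (Or.inr h)

theorem OK.closed {M : Tm} (h : M.Cl 0) : OK Sg M :=
  ⟨fun N => N.Cl 0, h, fun N hN => Or.inr (Or.inr ⟨N, Conv.rfl' N, hN⟩)⟩

theorem OK.var (x : ℕ) : OK Sg (.var x) :=
  ⟨fun N => N = .var x, rfl, fun N hN => Or.inr (Or.inl ⟨x, hN ▸ Conv.rfl' N⟩)⟩

theorem sub_apps (s : ℕ → Tm) (Ns : List Tm) : ∀ M, (apps M Ns).sub s =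
    apps (M.sub s) (Ns.map (Tm.sub s)) := by
  induction Ns with
  | nil => intro M; rfl
  | cons N Ns ih => intro M; exact ih _

theorem OK.sub {M : Tm} (h : OK Sg M) (s : ℕ → Tm) (hs : ∀ i, OK Sg (s i)) : OK Sg (M.sub s) := by
  refine ⟨fun N => OK Sg N ∨ ∃ M, OK Sg M ∧ Conv N (M.sub s),
    Or.inr ⟨M, h, Conv.rfl' _⟩, ?_⟩
  clear h M
  have lift : ∀ M, OK Sg M → OKStep Sg (fun N => OK Sg N ∨ ∃ M, OK Sg M ∧ Conv N (M.sub s)) M := by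
    intro M h
    rcases h.step with ⟨f, Ns, h1, h2, h3⟩ | h | h
    · exact Or.inl ⟨f, Ns, h1, h2, fun N hN => Or.inl (h3 N hN)⟩
    · exact Or.inr (Or.inl h)
    · exact Or.inr (Or.inr h)
  rintro N (h | ⟨M, h, hc⟩)
  · exact lift N h
  · rcases h.step with ⟨f, Ns, h1, h2, h3⟩ | ⟨x, h⟩ | ⟨L, h1, h2⟩
    · left
      refine ⟨f, Ns.map (Tm.sub s), ?_, by simpa using h2, ?_⟩
      · have := h1.sub s
        rw [sub_apps] at this
        exact hc.tr this
      · intro N hN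
        obtain ⟨L, hL, rfl⟩ := List.mem_map.1 hN
        exact Or.inr ⟨L, h3 L hL, Conv.rfl' _⟩
    · have hcx : Conv N (s x) := hc.tr (h.sub s)
      rcases lift _ (hs x) with ⟨f, Ns, h1, h2, h3⟩ | ⟨x, h⟩ | ⟨L, h1, h2⟩
      · exact Or.inl ⟨f, Ns, hcx.tr h1, h2, h3⟩
      · exact Or.inr (Or.inl ⟨x, hcx.tr h⟩)
      · exact Or.inr (Or.inr ⟨L, hcx.tr h1, h2⟩)
    · right; right
      have := h1.sub s
      rw [h2.sub_closed] at this
      exact ⟨L, hc.tr this, h2⟩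

theorem val_sub {M : Tm} (h : OK Sg M) (s : ℕ → Tm) :
    val ρ γ (M.sub s) = val ρ (fun i => val ρ γ (s i)) M := by
  refine gco_coind (fun x y => ∃ M : Tm, OK Sg M ∧ x = val ρ γ (M.sub s) ∧
    y = val ρ (fun i => val ρ γ (s i)) M) ?_ _ _ ⟨M, h, rfl, rfl⟩
  clear h M
  rintro x y ⟨M, h, rfl, rfl⟩
  rcases h.step with ⟨f, Ns, h1, h2, h3⟩ | ⟨x, h⟩ | ⟨L, h1, h2⟩
  · have h4 := h1.sub s
    rw [sub_apps] at h4
    rcases hf : ρ f with _ | t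
    · right
      refine ⟨f, _, _, val_prod h4 hf (by simpa using h2), val_prod h1 hf h2, fun i => ?_⟩
      refine ⟨_, h3 _ (List.get_mem _ _), ?_, rfl⟩
      simp only [List.get_eq_getElem, List.getElem_map]
      rfl
    · left
      rw [val_const h4 hf, val_const h1 hf]
  · left
    rw [val_var h, val_conv (h.sub s)]
    rfl
  · left
    rw [val_conv (h1.sub s), val_conv h1, h2.sub_closed]
    exact val_closed h2

/-! ## Coterm substitution -/

theorem substStep_inr (θ : ℕ → GCoTerm Sg) (t : GCoTerm Sg) :
    PFunctor.M.corec (substStep θ) (Sum.inr t) = t := by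
  refine gco_coind (fun x y => x = PFunctor.M.corec (substStep θ) (Sum.inr y)) ?_ _ _ rfl
  rintro x y rfl
  right
  obtain ⟨f, k, hk⟩ := gco_dest y
  refine ⟨f, fun i => PFunctor.M.corec (substStep θ) (Sum.inr (k i)), k, ?_, hk, fun i => rfl⟩
  rw [PFunctor.M.dest_corec]
  simp only [substStep, hk]
  rfl

theorem csubst_var {t : CoTerm Sg ℕ} {x : ℕ} {k} (h : PFunctor.M.dest t = ⟨Sum.inr x, k⟩)
    (θ : ℕ → GCoTerm Sg) : csubst t θ = θ x := by
  refine gco_coind (fun u v => (u = csubst t θ ∧ v = θ x) ∨ u = v) ?_ _ _ (Or.inl ⟨rfl, rfl⟩)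
  rintro u v (⟨rfl, rfl⟩ | rfl)
  · right
    obtain ⟨f, l, hl⟩ := gco_dest (θ x)
    refine ⟨f, l, l, ?_, hl, fun i => Or.inr rfl⟩
    rw [csubst, PFunctor.M.dest_corec]
    simp only [substStep, h, hl]
    exact congrArg (Sigma.mk (β := fun a => (coSig Sg Empty).B a → GCoTerm Sg) (Sum.inl f))
      (funext fun i => substStep_inr θ (l i))
  · left; rfl

theorem csubst_const {t : CoTerm Sg ℕ} {f : String} {k : Fin (Sg.ar f) → CoTerm Sg ℕ}
    (h : PFunctor.M.dest t = ⟨Sum.inl f, k⟩)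
    (θ : ℕ → GCoTerm Sg) :
    PFunctor.M.dest (csubst t θ) = ⟨Sum.inl f, fun i => csubst (k i) θ⟩ := by
  rw [csubst, PFunctor.M.dest_corec]
  simp only [substStep, h]
  rfl

end Valuation

/-! ## Typing -/

def bar : ℕ → Ty
  | 0 => .base
  | k + 1 => .arrow .base (bar k)

theorem bar_arity (k : ℕ) : (bar k).arity = k := by
  induction k with
  | zero => rfl
  | succ k ih => simp [bar, Ty.arity, ih]

theorem bar_order (k : ℕ) : (bar k).order ≤ 1 := by
  induction k with
  | zero => simp [bar, Ty.order]
  | succ k ih => simp [bar, Ty.order, ih]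

theorem eq_bar {τ : Ty} (h : τ.order ≤ 1) : τ = bar τ.arity := by
  induction τ with
  | base => rfl
  | arrow σ τ ih1 ih2 =>
    simp only [Ty.order, max_le_iff] at h
    have : σ = .base := by
      cases σ with
      | base => rfl
      | arrow a b => simp only [Ty.order] at h; omega
    subst this
    simp only [Ty.arity, bar]
    rw [← ih2 h.2]

section Typing

variable {Sg : Sig}

theorem HasTy.ren {Γ : Ctx} {M : Tm} {τ : Ty} (h : HasTy Sg Γ M τ) : ∀ {Γ' : Ctx} {r : ℕ → ℕ},
    (∀ n τ, Γ[n]? = some τ → Γ'[r n]? = some τ) → HasTy Sg Γ' (M.ren r) τ := by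
  have hu : ∀ {Γ Γ' : Ctx} {r : ℕ → ℕ} {σ : Ty}, (∀ n τ, Γ[n]? = some τ → Γ'[r n]? = some τ) →
      ∀ n τ, (σ :: Γ)[n]? = some τ → (σ :: Γ')[upr r n]? = some τ := by
    intro Γ Γ' r σ h n τ hn
    cases n with
    | zero => simpa [upr, scons] using hn
    | succ n => simpa [upr, scons] using h n τ (by simpa using hn)
  induction h with
  | var h => intro Γ' r hr; exact .var (hr _ _ h)
  | const h => intros; exact .const h
  | app _ _ ih1 ih2 => intro Γ' r hr; exact .app (ih1 hr) (ih2 hr)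
  | lam _ ih => intro Γ' r hr; exact .lam (ih (hu hr))
  | fixI _ ih => intro Γ' r hr; exact .fixI (ih (hu hr))

theorem HasTy.sub {Γ : Ctx} {M : Tm} {τ : Ty} (h : HasTy Sg Γ M τ) : ∀ {Γ' : Ctx} {s : ℕ → Tm},
    (∀ n τ, Γ[n]? = some τ → HasTy Sg Γ' (s n) τ) → HasTy Sg Γ' (M.sub s) τ := by
  have hu : ∀ {Γ Γ' : Ctx} {s : ℕ → Tm} {σ : Ty}, (∀ n τ, Γ[n]? = some τ → HasTy Sg Γ' (s n) τ) →
      ∀ n τ, (σ :: Γ)[n]? = some τ → HasTy Sg (σ :: Γ') (ups s n) τ := by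
    intro Γ Γ' s σ h n τ hn
    cases n with
    | zero => exact .var hn
    | succ n => exact (h n τ (by simpa using hn)).ren (fun n τ hn => by simpa using hn)
  induction h with
  | var h => intro Γ' r hr; exact hr _ _ h
  | const h => intros; exact .const h
  | app _ _ ih1 ih2 => intro Γ' r hr; exact .app (ih1 hr) (ih2 hr)
  | lam _ ih => intro Γ' r hr; exact .lam (ih (hu hr))
  | fixI _ ih => intro Γ' r hr; exact .fixI (ih (hu hr))

theorem HasTy.uniq {Γ : Ctx} {M : Tm} {τ : Ty} (h : HasTy Sg Γ M τ) : ∀ {τ'},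
    HasTy Sg Γ M τ' → τ = τ' := by
  induction h with
  | var h => intro τ' h2; cases h2 with | var h2 => rw [h] at h2; exact Option.some.inj h2
  | const h => intro τ' h2; cases h2 with | const h2 => rw [h] at h2; exact Option.some.inj h2
  | app _ _ ih1 ih2 =>
    intro τ' h2
    cases h2 with
    | app h3 h4 => have := ih1 h3; cases this; rfl
  | lam _ ih => intro τ' h2; cases h2 with | lam h2 => rw [ih h2]
  | fixI _ ih => intro τ' h2; cases h2 with | fixI h2 => rfl

theorem HasTy.noC {Γ : Ctx} {M : Tm} {τ : Ty} (h : HasTy Sg Γ M τ) {c : String}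
    (hc : Sg c = none) : M.NoC c := by
  induction h with
  | var h => trivial
  | const h => rintro rfl; rw [hc] at h; cases h
  | app _ _ ih1 ih2 => exact ⟨ih1, ih2⟩
  | lam _ ih => exact ih
  | fixI _ ih => exact ih

theorem rep_cons (k : ℕ) (Γ : Ctx) :
    List.replicate (k + 1) Ty.base ++ Γ = List.replicate k Ty.base ++ Ty.base :: Γ := by
  rw [List.replicate_succ']; simp

theorem rep_add (m k : ℕ) (Γ : Ctx) : List.replicate (m + k) Ty.base ++ Γ =
    List.replicate k Ty.base ++ (List.replicate m Ty.base ++ Γ) := by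
  rw [add_comm, List.replicate_add, List.append_assoc]

theorem lams_ty (k : ℕ) : ∀ {Γ : Ctx} {M : Tm},
    HasTy Sg (List.replicate k Ty.base ++ Γ) M .base → HasTy Sg Γ (lams k M) (bar k) := by
  induction k with
  | zero => intro Γ M h; exact h
  | succ k ih =>
    intro Γ M h
    rw [rep_cons] at h
    exact .lam (ih h)

theorem apps_ty {Γ : Ctx} (Ns : List Tm) : ∀ {M : Tm} {j : ℕ}, HasTy Sg Γ M (bar (Ns.length + j)) →
    (∀ N ∈ Ns, HasTy Sg Γ N .base) → HasTy Sg Γ (apps M Ns) (bar j) := by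
  induction Ns with
  | nil => intro M j h _; simpa [apps] using h
  | cons N Ns ih =>
    intro M j h hN
    refine ih (M := .app M N) (.app (σ := .base) ?_ (hN N (by simp))) (fun N h => hN N (by simp [h]))
    have : (N :: Ns).length + j = (Ns.length + j) + 1 := by simp; omega
    rw [this] at h
    exact h

theorem lams_add (m k : ℕ) (M : Tm) : lams (m + k) M = lams m (lams k M) := by
  induction m with
  | zero => simp [lams]
  | succ m ih => rw [Nat.succ_add]; simp [lams, ih]

def upsn : ℕ → (ℕ → Tm) → ℕ → Tm
  | 0, s => s
  | k + 1, s => upsn k (ups s)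

theorem sub_lams (k : ℕ) : ∀ (s : ℕ → Tm) (M : Tm),
    (lams k M).sub s = lams k (M.sub (upsn k s)) := by
  induction k with
  | zero => intros; rfl
  | succ k ih => intro s M; simp [lams, Tm.sub, upsn, ih]

def insts : List Tm → (ℕ → Tm) → ℕ → Tm
  | [], s => s
  | N :: Ns, s => insts Ns (scons N s)

theorem betas (Ns : List Tm) : ∀ (s : ℕ → Tm) (B : Tm),
    Conv (apps ((lams Ns.length B).sub s) Ns) (B.sub (insts Ns s)) := by
  induction Ns with
  | nil => intro s B; exact Conv.rfl' _
  | cons N Ns ih =>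
    intro s B
    refine Conv.tr ?_ (ih (scons N s) B)
    refine Conv.appsL Ns ?_
    rw [← Tm.sub_ups_scons, ← Tm.subst_zero]
    exact .rel _ _ .beta

theorem insts_mem (Ns : List Tm) : ∀ (s : ℕ → Tm) (i : ℕ), insts Ns s i ∈ Ns ∨
    (Ns.length ≤ i ∧ insts Ns s i = s (i - Ns.length)) := by
  induction Ns with
  | nil => intro s i; right; simp [insts]
  | cons N Ns ih =>
    intro s i
    rcases ih (scons N s) i with h | ⟨h1, h2⟩
    · left; exact List.mem_cons_of_mem _ h
    · simp only [insts, List.length_cons]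
      rw [h2]
      rcases hi : i - Ns.length with _ | j
      · left; simp [scons]
      · right
        refine ⟨by omega, ?_⟩
        have : i - (Ns.length + 1) = j := by omega
        rw [this]; rfl

theorem insts_lt (Ns : List Tm) : ∀ (s t : ℕ → Tm) (i : ℕ), i < Ns.length →
    insts Ns s i = insts Ns t i := by
  have aux : ∀ (Ns : List Tm) (m : ℕ) (s t : ℕ → Tm), (∀ i < m, s i = t i) →
      ∀ i < m + Ns.length, insts Ns s i = insts Ns t i := by
    intro Ns
    induction Ns with
    | nil => intro m s t h; simpa [insts] using h
    | cons N Ns ih =>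
      intro m s t h i hi
      refine ih (m + 1) (scons N s) (scons N t) ?_ i (by simp at hi; omega)
      intro i hi
      cases i with
      | zero => rfl
      | succ i => exact h i (by omega)
  intro s t i hi
  exact aux Ns 0 s t (by omega) i (by omega)

theorem upsn_insts (Ns : List Tm) : ∀ (s t : ℕ → Tm),
    (fun i => (upsn Ns.length s i).sub (insts Ns t)) = insts Ns (fun j => (s j).sub t) := by
  induction Ns with
  | nil => intros; rfl
  | cons N Ns ih =>
    intro s t
    have := ih (ups s) (scons N t)
    simp only [List.length_cons, upsn, insts]
    rw [this]
    congr 1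
    funext j
    cases j with
    | zero => rfl
    | succ j => simp only [ups, scons, Tm.sub_ren]

/-! ## Guarded terms -/

theorem GBase.cl {Γ : Ctx} {M : Tm} {τ : Ty} (h : GBase Sg Γ M τ) : M.Cl Γ.length := by
  have lamsCl : ∀ (k l : ℕ) (M : Tm), M.Cl (k + l) → (lams k M).Cl l := by
    intro k
    induction k with
    | zero => intro l M h; simpa [lams] using h
    | succ k ih =>
      intro l M h
      refine ih (l + 1) M ?_
      have : k + (l + 1) = k + 1 + l := by omega
      rw [this]; exact h
  have appsCl : ∀ (k : ℕ) (Ns : List Tm) (M : Tm), M.Cl k → (∀ N ∈ Ns, N.Cl k) →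
      (apps M Ns).Cl k := by
    intro k Ns
    induction Ns with
    | nil => intro M h _; exact h
    | cons N Ns ih =>
      intro M h hN
      exact ih _ ⟨h, hN N (by simp)⟩ (fun N h => hN N (by simp [h]))
  induction h with
  | var h _ =>
    obtain ⟨h, _⟩ := List.getElem?_eq_some_iff.1 h
    exact h
  | const => trivial
  | app _ _ ih1 ih2 => exact ⟨ih1, ih2⟩
  | fixI _ _ _ _ ih =>
    refine lamsCl _ _ _ (appsCl _ _ _ trivial ?_)
    intro M hM
    have := ih M hM
    simpa using this

theorem ren_lams (k : ℕ) (r : ℕ → ℕ) (M : Tm) : (lams k M).ren r =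
    lams k (M.sub (upsn k (fun n => .var (r n)))) := by
  rw [Tm.ren_eq_sub, sub_lams]

def uprn : ℕ → (ℕ → ℕ) → ℕ → ℕ
  | 0, r => r
  | k + 1, r => uprn k (upr r)

theorem upsn_ren (k : ℕ) : ∀ (r : ℕ → ℕ),
    upsn k (fun n => .var (r n)) = fun n => .var (uprn k r n) := by
  induction k with
  | zero => intro r; rfl
  | succ k ih => intro r; simp only [upsn, uprn, ups_ren, ih]

/-- Substitutions preserving guarded base terms. -/
def GSub (Sg : Sig) (Γ Γ' : Ctx) (s : ℕ → Tm) : Prop :=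
  ∀ n τ, Γ[n]? = some τ → τ.order ≤ 1 → GBase Sg Γ' (s n) τ

def CRen (Γ Γ' : Ctx) (r : ℕ → ℕ) : Prop := ∀ n τ, Γ[n]? = some τ → Γ'[r n]? = some τ

theorem CRen.upr {Γ Γ' : Ctx} {r : ℕ → ℕ} (h : CRen Γ Γ' r) (σ : Ty) :
    CRen (σ :: Γ) (σ :: Γ') (upr r) := by
  intro n τ hn
  cases n with
  | zero => simpa [_root_.upr, scons] using hn
  | succ n => simpa [_root_.upr, scons] using h n τ (by simpa using hn)

theorem CRen.uprn (k : ℕ) : ∀ {Γ Γ' : Ctx} {r : ℕ → ℕ}, CRen Γ Γ' r →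
    CRen (List.replicate k Ty.base ++ Γ) (List.replicate k Ty.base ++ Γ') (uprn k r) := by
  induction k with
  | zero => intro Γ Γ' r h; simpa [_root_.uprn] using h
  | succ k ih =>
    intro Γ Γ' r h
    rw [rep_cons, rep_cons]
    exact ih (h.upr _)

theorem sub_fix_form (s : ℕ → Tm) (τ : Ty) (k : ℕ) (f : String) (Ms : List Tm) :
    (Tm.fix τ (lams k (apps (.const f) Ms))).sub s =
      .fix τ (lams k (apps (.const f) (Ms.map (Tm.sub (upsn k (ups s)))))) := by
  simp only [Tm.sub, sub_lams, sub_apps]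

theorem GBase.ren {Γ : Ctx} {M : Tm} {τ : Ty} (h : GBase Sg Γ M τ) :
    ∀ {Γ' : Ctx} {r : ℕ → ℕ}, CRen Γ Γ' r → GBase Sg Γ' (M.ren r) τ := by
  induction h with
  | var h h2 => intro Γ' r hr; exact .var (hr _ _ h) h2
  | const h => intros; exact .const h
  | app _ _ ih1 ih2 => intro Γ' r hr; exact .app (ih1 hr) (ih2 hr)
  | fixI h1 h2 h3 _ ih =>
    intro Γ' r hr
    rw [Tm.ren_eq_sub, sub_fix_form, ups_ren, upsn_ren]
    refine .fixI h1 h2 (by simpa using h3) ?_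
    intro M hM
    obtain ⟨M1, hM1, rfl⟩ := List.mem_map.1 hM
    rw [← Tm.ren_eq_sub]
    exact ih M1 hM1 ((hr.upr _).uprn _)

theorem GSub.ups {Γ Γ' : Ctx} {s : ℕ → Tm} (h : GSub Sg Γ Γ' s) (σ : Ty) :
    GSub Sg (σ :: Γ) (σ :: Γ') (ups s) := by
  intro n τ hn ho
  cases n with
  | zero => exact .var hn ho
  | succ n => exact (h n τ (by simpa using hn) ho).ren (fun n τ hn => by simpa using hn)

theorem GSub.upsn (k : ℕ) : ∀ {Γ Γ' : Ctx} {s : ℕ → Tm}, GSub Sg Γ Γ' s →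
    GSub Sg (List.replicate k Ty.base ++ Γ) (List.replicate k Ty.base ++ Γ') (upsn k s) := by
  induction k with
  | zero => intro Γ Γ' r h; simpa [_root_.upsn] using h
  | succ k ih =>
    intro Γ Γ' r h
    rw [rep_cons, rep_cons]
    exact ih (h.ups _)

theorem GBase.sub {Γ : Ctx} {M : Tm} {τ : Ty} (h : GBase Sg Γ M τ) :
    ∀ {Γ' : Ctx} {s : ℕ → Tm}, GSub Sg Γ Γ' s → GBase Sg Γ' (M.sub s) τ := by
  induction h with
  | var h h2 => intro Γ' r hr; exact hr _ _ h h2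
  | const h => intros; exact .const h
  | app _ _ ih1 ih2 => intro Γ' r hr; exact .app (ih1 hr) (ih2 hr)
  | fixI h1 h2 h3 _ ih =>
    intro Γ' r hr
    rw [sub_fix_form]
    refine .fixI h1 h2 (by simpa using h3) ?_
    intro M hM
    obtain ⟨M1, hM1, rfl⟩ := List.mem_map.1 hM
    exact ih M1 hM1 ((hr.ups _).upsn _)

theorem GBase.hasTy (hSg : Sg.FirstOrder) {Γ : Ctx} {M : Tm} {τ : Ty} (h : GBase Sg Γ M τ) :
    HasTy Sg Γ M τ := by
  induction h with
  | var h _ => exact .var h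
  | const h => exact .const h
  | app _ _ ih1 ih2 => exact .app ih1 ih2
  | @fixI Γ f σf τ Ms h1 h2 h3 _ ih =>
    refine .fixI ?_
    have := lams_ty (Sg := Sg) τ.arity (Γ := τ :: Γ) (M := apps (.const f) Ms)
      (apps_ty Ms (j := 0) ?_ ih)
    · rw [← eq_bar h2] at this
      exact this
    · refine .const ?_
      rw [h1, eq_bar (hSg _ _ h1), h3]
      rfl

theorem Guarded.ren {M : Tm} (h : Guarded Sg M) : ∀ {r : ℕ → ℕ}, Guarded Sg (M.ren r) := by
  induction h with
  | base h => intro r; rw [Tm.Cl.ren_closed h.cl]; exact .base h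
  | const => intros; exact .const
  | var => intros; exact .var
  | app _ _ ih1 ih2 => intros; exact .app ih1 ih2
  | lam _ ih => intros; exact .lam ih

theorem Guarded.sub {M : Tm} (h : Guarded Sg M) : ∀ {s : ℕ → Tm}, (∀ i, Guarded Sg (s i)) →
    Guarded Sg (M.sub s) := by
  induction h with
  | base h => intro r _; rw [Tm.Cl.sub_closed h.cl]; exact .base h
  | const => intros; exact .const
  | var => intro s hs; exact hs _
  | app _ _ ih1 ih2 => intro s hs; exact .app (ih1 hs) (ih2 hs)
  | lam _ ih =>
    intro s hs
    refine .lam (ih ?_)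
    intro i
    cases i with
    | zero => exact .var
    | succ i => exact (hs i).ren

theorem Guarded.apps (Ns : List Tm) : ∀ {M : Tm}, Guarded Sg M → (∀ N ∈ Ns, Guarded Sg N) →
    Guarded Sg (apps M Ns) := by
  induction Ns with
  | nil => intro M h _; exact h
  | cons N Ns ih =>
    intro M h hN
    exact ih (.app h (hN N (by simp))) (fun N h => hN N (by simp [h]))

/-! ## Head normalisation of guarded terms -/

/-- First-order guarded terms in a context of `n` base variables. -/
def GT (Sg : Sig) (n : ℕ) (M : Tm) : Prop :=
  Guarded Sg M ∧ HasTy Sg (List.replicate n .base) M .base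

def HN (Sg : Sig) (n : ℕ) (M : Tm) : Prop :=
  (∃ f Ns, Sg f ≠ none ∧ Conv M (apps (.const f) Ns) ∧ Ns.length = Sg.ar f ∧
    ∀ N ∈ Ns, GT Sg n N) ∨ ∃ x, Conv M (.var x)

theorem HN.conv {n : ℕ} {M N : Tm} (h : HN Sg n N) (hc : Conv M N) : HN Sg n M := by
  rcases h with ⟨f, Ns, h1, h2, h3⟩ | ⟨x, h⟩
  · exact Or.inl ⟨f, Ns, h1, hc.tr h2, h3⟩
  · exact Or.inr ⟨x, hc.tr h⟩

/-- The logical relation. -/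
def LR (Sg : Sig) (n : ℕ) : Ty → Tm → Prop
  | .base, M => Guarded Sg M ∧ HasTy Sg (List.replicate n .base) M .base ∧ HN Sg n M
  | .arrow σ τ, M => Guarded Sg M ∧ HasTy Sg (List.replicate n .base) M (.arrow σ τ) ∧
      ∀ N, LR Sg n σ N → LR Sg n τ (.app M N)

theorem LR.guarded {n : ℕ} {τ : Ty} {M : Tm} (h : LR Sg n τ M) : Guarded Sg M := by
  cases τ <;> exact h.1

theorem LR.hasTy {n : ℕ} {τ : Ty} {M : Tm} (h : LR Sg n τ M) :
    HasTy Sg (List.replicate n .base) M τ := by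
  cases τ <;> exact h.2.1

theorem LR.conv {n : ℕ} {τ : Ty} : ∀ {M N : Tm}, LR Sg n τ N → Conv M N → Guarded Sg M →
    HasTy Sg (List.replicate n .base) M τ → LR Sg n τ M := by
  induction τ with
  | base => intro M N h hc h1 h2; exact ⟨h1, h2, h.2.2.conv hc⟩
  | arrow σ τ ih1 ih2 =>
    intro M N h hc h1 h2
    refine ⟨h1, h2, fun L hL => ?_⟩
    exact ih2 (h.2.2 L hL) (hc.appL L) (.app h1 hL.guarded) (.app h2 hL.hasTy)

theorem LR.bar {n : ℕ} (k : ℕ) : ∀ {M : Tm}, Guarded Sg M →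
    HasTy Sg (List.replicate n .base) M (bar k) →
    (∀ Ns : List Tm, Ns.length = k → (∀ N ∈ Ns, GT Sg n N) → HN Sg n (apps M Ns)) →
    LR Sg n (bar k) M := by
  induction k with
  | zero => intro M h1 h2 h3; exact ⟨h1, h2, h3 [] rfl (by simp)⟩
  | succ k ih =>
    intro M h1 h2 h3
    refine ⟨h1, h2, fun N hN => ih (.app h1 hN.guarded) (.app h2 hN.hasTy) ?_⟩
    intro Ns hl hNs
    refine h3 (N :: Ns) (by simp [hl]) ?_
    intro L hL
    rcases List.mem_cons.1 hL with rfl | h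
    · exact ⟨hN.guarded, hN.hasTy⟩
    · exact hNs L h

theorem getElem_rep {n i : ℕ} {τ : Ty} (h : (List.replicate n Ty.base)[i]? = some τ) :
    i < n ∧ τ = .base := by
  rw [List.getElem?_replicate] at h
  split at h
  · exact ⟨by assumption, (Option.some.inj h).symm⟩
  · cases h

theorem HasTy.weaken0 {M : Tm} {τ : Ty} (h : HasTy Sg [] M τ) (hc : M.Cl 0) (Γ : Ctx) :
    HasTy Sg Γ M τ := by
  have := h.ren (Γ' := Γ) (r := id) (by simp)
  rwa [hc.ren_closed] at this

/-- Lifting: an instance of an open guarded base term is convertible to a guarded term. -/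
theorem lift_guarded (hSg : Sg.FirstOrder) {n : ℕ} {Γ : Ctx} {M : Tm} {τ : Ty}
    (h : GBase Sg Γ M τ) : ∀ (Ns : List Tm), Γ = List.replicate Ns.length Ty.base →
    (∀ N ∈ Ns, GT Sg n N) → ∃ L, Guarded Sg L ∧ HasTy Sg (List.replicate n .base) L τ ∧
      Conv (M.sub (insts Ns Tm.var)) L := by
  induction h with
  | @var Γ i τ h _ =>
    rintro Ns rfl hNs
    obtain ⟨hi, rfl⟩ := getElem_rep h
    rcases insts_mem Ns Tm.var i with h | h
    · exact ⟨_, (hNs _ h).1, (hNs _ h).2, Conv.rfl' _⟩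
    · omega
  | const h => intro Ns _ _; exact ⟨_, .const, .const h, Conv.rfl' _⟩
  | app _ _ ih1 ih2 =>
    intro Ns hΓ hNs
    obtain ⟨L1, a1, b1, c1⟩ := ih1 Ns hΓ hNs
    obtain ⟨L2, a2, b2, c2⟩ := ih2 Ns hΓ hNs
    exact ⟨.app L1 L2, .app a1 a2, .app b1 b2, (c1.appL _).tr (c2.appR _)⟩
  | @fixI Γ f σf τ Ms h1 h2 h3 h4 _ =>
    rintro Ns rfl hNs
    have hM : GBase Sg _ _ τ := .fixI h1 h2 h3 h4
    set M := Tm.fix τ (lams τ.arity (apps (.const f) Ms)) with hMdef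
    set m := Ns.length with hm
    set k := τ.arity with hk
    set Ms' := Ms.map (Tm.sub (upsn k (scons M Tm.var))) with hMs'
    have hU : Tm.subst 0 M (lams k (apps (.const f) Ms)) = lams k (apps (.const f) Ms') := by
      rw [Tm.subst_zero, sub_lams, sub_apps]; rfl
    have hred : Red M (lams k (apps (.const f) Ms')) := by
      rw [← hU]; exact .fixUnfold
    set U := lams k (apps (.const f) Ms') with hUdef
    have hL : GBase Sg [] (Tm.fix (_root_.bar (m + k)) (lams m U)) (_root_.bar (m + k)) := by
      have := @GBase.fixI Sg [] f σf (_root_.bar (m + k)) Ms' h1 (bar_order _)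
        (by simpa [hMs'] using h3) ?_
      · rwa [bar_arity, lams_add] at this
      · intro N hN
        obtain ⟨N1, hN1, rfl⟩ := List.mem_map.1 hN
        rw [bar_arity, rep_add]
        refine (h4 N1 hN1).sub (GSub.upsn k ?_)
        intro i σ hi ho
        cases i with
        | zero =>
          simp at hi
          subst hi
          have := hM.ren (Γ' := List.replicate m Ty.base ++ [_root_.bar (m + k)]) (r := id) (by
            intro i σ hi
            have := getElem_rep hi
            rw [List.getElem?_append_left (by simpa using this.1)]
            exact hi)
          rw [Tm.ren_eq_sub] at this
          exact (Tm.sub_var M) ▸ this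
        | succ i =>
          refine .var ?_ ho
          simp only [List.getElem?_cons_succ] at hi
          have := getElem_rep hi
          rw [List.getElem?_append_left (by simpa using this.1)]
          exact hi
    set L := Tm.fix (_root_.bar (m + k)) (lams m U) with hLdef
    refine ⟨apps L Ns, Guarded.apps Ns (.base hL) (fun N h => (hNs N h).1), ?_, ?_⟩
    · rw [eq_bar h2]
      exact apps_ty Ns ((hL.hasTy hSg).weaken0 hL.cl _) (fun N h => (hNs N h).2)
    · have c1 : Conv (M.sub (insts Ns Tm.var)) (U.sub (insts Ns Tm.var)) :=
        .rel _ _ (hred.sub _)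
      have hUc : U.Cl m := by
        have := hred.cl hM.cl
        simpa using this
      have c2 : Conv (apps L Ns) (U.sub (insts Ns (scons L Tm.var))) := by
        refine Conv.tr ?_ (betas Ns (scons L Tm.var) U)
        refine Conv.appsL Ns ?_
        rw [← Tm.subst_zero]
        exact .rel _ _ .fixUnfold
      rw [hUc.sub_congr (s2 := insts Ns Tm.var) (fun i hi => insts_lt Ns _ _ i hi)] at c2
      exact c1.tr c2.sym

theorem conv_list {S : Tm → Prop} (Ns : List Tm) (h : ∀ N ∈ Ns, ∃ L, S L ∧ Conv N L) :
    ∃ Ls, List.Forall₂ Conv Ns Ls ∧ ∀ L ∈ Ls, S L := by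
  induction Ns with
  | nil => exact ⟨[], .nil, by simp⟩
  | cons N Ns ih =>
    obtain ⟨Ls, h1, h2⟩ := ih (fun N hN => h N (by simp [hN]))
    obtain ⟨L, h3, h4⟩ := h N (by simp)
    exact ⟨L :: Ls, .cons h4 h1, by simpa using ⟨h3, h2⟩⟩

theorem sig_ar {f : String} {τ : Ty} (h : Sg f = some τ) : Sg.ar f = τ.arity := by
  simp [Sig.ar, h]

theorem LR.const (hSg : Sg.FirstOrder) {n : ℕ} {c : String} {τ : Ty} (h : Sg c = some τ) :
    LR Sg n τ (.const c) := by
  have hτ := eq_bar (hSg _ _ h)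
  rw [hτ]
  refine LR.bar _ .const (.const (hτ ▸ h)) ?_
  intro Ns hl hNs
  exact Or.inl ⟨c, Ns, by simp [h], Conv.rfl' _, by rw [hl, sig_ar h], hNs⟩

theorem LR.gbase (hSg : Sg.FirstOrder) {n : ℕ} {Γ : Ctx} {M : Tm} {τ : Ty}
    (h : GBase Sg Γ M τ) : Γ = [] → LR Sg n τ M := by
  induction h with
  | var h _ => rintro rfl; simp at h
  | const h => intro _; exact LR.const hSg h
  | app _ _ ih1 ih2 => intro hΓ; exact (ih1 hΓ).2.2 _ (ih2 hΓ)
  | @fixI Γ f σf τ Ms h1 h2 h3 h4 _ =>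
    rintro rfl
    have hM : GBase Sg _ _ τ := .fixI h1 h2 h3 h4
    set M := Tm.fix τ (lams τ.arity (apps (.const f) Ms)) with hMdef
    have hτ := eq_bar h2
    have hty : HasTy Sg (List.replicate n .base) M (_root_.bar τ.arity) := by
      rw [← hτ]; exact (hM.hasTy hSg).weaken0 hM.cl _
    have := LR.bar τ.arity (Guarded.base hM) hty ?_
    · rw [← hτ] at this; exact this
    intro Ns hl hNs
    have c1 : Conv (apps M Ns) ((apps (.const f) Ms).sub (insts Ns (scons M Tm.var))) := by
      refine Conv.tr ?_ (betas Ns (scons M Tm.var) _)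
      refine Conv.appsL Ns ?_
      rw [← Tm.subst_zero, hl]
      exact .rel _ _ .fixUnfold
    rw [sub_apps] at c1
    obtain ⟨Ls, hLs, hLs2⟩ := conv_list (S := GT Sg n)
      (Ms.map (Tm.sub (insts Ns (scons M Tm.var)))) (by
        intro N hN
        obtain ⟨N1, hN1, rfl⟩ := List.mem_map.1 hN
        have hg := (h4 N1 hN1).sub (Γ' := List.replicate τ.arity Ty.base ++ [])
          (GSub.upsn τ.arity (s := scons M Tm.var) (by
            intro i σ hi ho
            cases i with
            | zero => simp at hi; subst hi; exact hM
            | succ i => simp at hi))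
        rw [List.append_nil, ← hl] at hg
        obtain ⟨L, a, b, c⟩ := lift_guarded hSg (n := n) hg Ns rfl hNs
        refine ⟨L, ⟨a, b⟩, ?_⟩
        rw [Tm.sub_sub, upsn_insts] at c
        have : (fun j => (scons M Tm.var j).sub Tm.var) = scons M Tm.var := by
          funext j; exact Tm.sub_var _
        rw [this] at c
        exact c)
    refine Or.inl ⟨f, Ls, by simp [h1], c1.tr (Conv.apps hLs (Conv.rfl' _)), ?_, hLs2⟩
    rw [← hLs.length_eq, List.length_map, h3, sig_ar h1]

theorem LR.fundamental (hSg : Sg.FirstOrder) {n : ℕ} {M : Tm} (h : Guarded Sg M) :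
    ∀ {Γ : Ctx} {τ : Ty} {s : ℕ → Tm}, HasTy Sg Γ M τ → (∀ i, Guarded Sg (s i)) →
    (∀ i τ, Γ[i]? = some τ → LR Sg n τ (s i)) → LR Sg n τ (M.sub s) := by
  induction h with
  | base h =>
    intro Γ τ s ht _ _
    have := ((h.hasTy hSg).weaken0 h.cl Γ).uniq ht
    subst this
    rw [Tm.Cl.sub_closed h.cl]
    exact LR.gbase hSg h rfl
  | const => intro Γ τ s ht _ _; cases ht with | const h => exact LR.const hSg h
  | var => intro Γ τ s ht _ hs; cases ht with | var h => exact hs _ _ h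
  | app _ _ ih1 ih2 =>
    intro Γ τ s ht h1 h2
    cases ht with
    | app ha hb => exact (ih1 ha h1 h2).2.2 _ (ih2 hb h1 h2)
  | @lam σ M hg ih =>
    intro Γ τ s ht h1 h2
    have hG : Guarded Sg ((Tm.lam σ M).sub s) := (Guarded.lam hg).sub h1
    have hT := ht.sub (Γ' := List.replicate n .base) (fun i τ hi => (h2 i τ hi).hasTy)
    cases ht with
    | lam ht =>
      refine ⟨hG, hT, fun N hN => ?_⟩
      have key := ih (s := scons N s) ht (by
        intro i
        cases i with
        | zero => exact hN.guarded
        | succ i => exact h1 i) (by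
        intro i τ hi
        cases i with
        | zero => simp at hi; subst hi; exact hN
        | succ i => exact h2 i τ (by simpa using hi))
      refine key.conv ?_ (.app hG hN.guarded) (.app hT hN.hasTy)
      rw [← Tm.sub_ups_scons, ← Tm.subst_zero]
      exact .rel _ _ .beta

theorem GT.hn (hSg : Sg.FirstOrder) {n : ℕ} {M : Tm} (h : GT Sg n M) : HN Sg n M := by
  have := LR.fundamental hSg (n := n) h.1 (s := Tm.var) h.2 (fun _ => .var) (by
    intro i τ hi
    obtain ⟨_, rfl⟩ := getElem_rep hi
    exact ⟨.var, .var hi, Or.inr ⟨i, Conv.rfl' _⟩⟩)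
  rw [Tm.sub_var] at this
  exact this.2.2

theorem GT.ok (hSg : Sg.FirstOrder) {n : ℕ} {M : Tm} (h : GT Sg n M) : OK Sg M := by
  refine ⟨GT Sg n, h, fun M hM => ?_⟩
  rcases hM.hn hSg with ⟨f, Ns, _, h1, h2, h3⟩ | h
  · exact Or.inl ⟨f, Ns, h1, h2, h3⟩
  · exact Or.inr (Or.inl h)

/-- The valuation agrees with any coterm semantics on first-order guarded terms. -/
theorem GT.val_eq (hSg : Sg.FirstOrder) {sem : Tm → CoTerm Sg ℕ} (hsem : SemSpec Sg sem)
    {n : ℕ} {M : Tm} (h : GT Sg n M) {ρ : String → Option (GCoTerm Sg)}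
    (hρ : ∀ c, Sg c ≠ none → ρ c = none) (γ : ℕ → GCoTerm Sg) :
    val ρ γ M = csubst (sem M) γ := by
  refine gco_coind (fun x y => ∃ M, GT Sg n M ∧ x = val ρ γ M ∧ y = csubst (sem M) γ) ?_ _ _
    ⟨M, h, rfl, rfl⟩
  clear h M
  rintro x y ⟨M, h, rfl, rfl⟩
  rcases h.hn hSg with ⟨f, Ns, h1, h2, h3, h4⟩ | ⟨x, h⟩
  · right
    have hd := hsem.2.1 _ f Ns h3 (fun N hN => (h4 N hN).1) .refl
    rw [← hsem.1 _ _ h2] at hd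
    refine ⟨f, _, _, val_prod h2 (hρ f h1) h3, csubst_const hd γ, fun i => ?_⟩
    exact ⟨_, h4 _ (List.get_mem _ _), rfl, rfl⟩
  · left
    have hd := hsem.2.2 _ x .refl
    rw [← hsem.1 _ _ h] at hd
    rw [val_var h, csubst_var hd]

end Typing

/-! ## Two-sorted semantics of formulae -/

section FmSemantics

variable {Sg : Sig}

/-- Truth of a formula; negative atoms are read in `J`, the positive ones in `K`. -/
def FmV (ρ : String → Option (GCoTerm Sg)) (J : Set (HBase Sg)) :
    Set (HBase Sg) → Fm → (ℕ → GCoTerm Sg) → Prop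
  | K, .atom p Ms, γ => (p, Ms.map (val ρ γ)) ∈ K
  | _, .top, _ => True
  | K, .conj φ ψ, γ => FmV ρ J K φ γ ∧ FmV ρ J K ψ γ
  | K, .disj φ ψ, γ => FmV ρ J K φ γ ∨ FmV ρ J K ψ γ
  | K, .impl φ ψ, γ => FmV ρ J J φ γ → FmV ρ J K ψ γ
  | K, .all _ φ, γ => ∀ t, FmV ρ J K φ (consEnv t γ)
  | K, .ex _ φ, γ => ∃ t, FmV ρ J K φ (consEnv t γ)
  | K, .later φ, γ => FmV ρ J K φ γ

/-- Horn goals. -/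
def HG (Sg : Sig) : Fm → Prop
  | .atom _ Ms => ∀ M ∈ Ms, OK Sg M
  | .top => True
  | .conj φ ψ => HG Sg φ ∧ HG Sg ψ
  | _ => False

/-- Horn definite formulae. -/
def HD (Sg : Sig) : Fm → Prop
  | .atom _ Ms => ∀ M ∈ Ms, OK Sg M
  | .top => True
  | .conj φ ψ => HD Sg φ ∧ HD Sg ψ
  | .impl φ ψ => HG Sg φ ∧ HD Sg ψ
  | .all _ φ => HD Sg φ
  | _ => False

theorem HG.hd {φ : Fm} (h : HG Sg φ) : HD Sg φ := by
  induction φ with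
  | atom p Ms => exact h
  | top => trivial
  | conj a b iha ihb => exact ⟨iha h.1, ihb h.2⟩
  | _ => exact h.elim

/-- Absence of a constant in a formula. -/
def Fm.NoC (c : String) : Fm → Prop
  | .atom _ Ms => ∀ M ∈ Ms, M.NoC c
  | .top => True
  | .conj φ ψ => φ.NoC c ∧ ψ.NoC c
  | .disj φ ψ => φ.NoC c ∧ ψ.NoC c
  | .impl φ ψ => φ.NoC c ∧ ψ.NoC c
  | .all _ φ => φ.NoC c
  | .ex _ φ => φ.NoC c
  | .later φ => φ.NoC c

theorem single_cases (k : ℕ) {N : Tm} (hN : N.Cl 0) (i : ℕ) :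
    single k N i = N ∨ ∃ j, single k N i = .var j := by
  unfold single
  split
  · left; exact hN.ren_closed _
  · split
    · right; exact ⟨_, rfl⟩
    · right; exact ⟨_, rfl⟩

theorem single_ok (k : ℕ) {N : Tm} (hN : N.Cl 0) (i : ℕ) : OK Sg (single k N i) := by
  rcases single_cases k hN i with h | ⟨j, h⟩
  · rw [h]; exact OK.closed hN
  · rw [h]; exact OK.var j

theorem single_noC {c : String} (k : ℕ) {N : Tm} (hN : N.Cl 0) (hc : N.NoC c) (i : ℕ) :
    (single k N i).NoC c := by
  rcases single_cases k hN i with h | ⟨j, h⟩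
  · rw [h]; exact hc
  · rw [h]; trivial

theorem atom_subst_ok {Ms : List Tm} (h : ∀ M ∈ Ms, OK Sg M) (k : ℕ) {N : Tm} (hN : N.Cl 0) :
    ∀ M ∈ Ms.map (Tm.subst k N), OK Sg M := by
  intro M hM
  obtain ⟨M1, hM1, rfl⟩ := List.mem_map.1 hM
  rw [Tm.subst_eq]
  exact (h M1 hM1).sub _ (single_ok k hN)

theorem HG.subst {φ : Fm} : ∀ {k : ℕ} {N : Tm}, HG Sg φ → N.Cl 0 → HG Sg (φ.subst k N) := by
  induction φ with
  | atom p Ms => intro k N h hN; exact atom_subst_ok h k hN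
  | top => intros; trivial
  | conj a b iha ihb => intro k N h hN; exact ⟨iha h.1 hN, ihb h.2 hN⟩
  | _ => intro k N h; exact h.elim

theorem HD.subst {φ : Fm} : ∀ {k : ℕ} {N : Tm}, HD Sg φ → N.Cl 0 → HD Sg (φ.subst k N) := by
  induction φ with
  | atom p Ms => intro k N h hN; exact atom_subst_ok h k hN
  | top => intros; trivial
  | conj a b iha ihb => intro k N h hN; exact ⟨iha h.1 hN, ihb h.2 hN⟩
  | impl a b iha ihb => intro k N h hN; exact ⟨h.1.subst hN, ihb h.2 hN⟩
  | all τ a ih => intro k N h hN; exact ih (k := k + 1) h hN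
  | _ => intro k N h; exact h.elim

theorem Fm.NoC.subst {c : String} {φ : Fm} : ∀ {k : ℕ} {N : Tm}, φ.NoC c → N.Cl 0 → N.NoC c →
    (φ.subst k N).NoC c := by
  induction φ with
  | atom p Ms =>
    intro k N h hN hc M hM
    obtain ⟨M1, hM1, rfl⟩ := List.mem_map.1 hM
    rw [Tm.subst_eq]
    exact (h M1 hM1).sub (single_noC k hN hc)
  | top => intros; trivial
  | conj a b iha ihb => intro k N h hN hc; exact ⟨iha h.1 hN hc, ihb h.2 hN hc⟩
  | disj a b iha ihb => intro k N h hN hc; exact ⟨iha h.1 hN hc, ihb h.2 hN hc⟩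
  | impl a b iha ihb => intro k N h hN hc; exact ⟨iha h.1 hN hc, ihb h.2 hN hc⟩
  | all τ a ih => intro k N h hN hc; exact ih (k := k + 1) h hN hc
  | ex τ a ih => intro k N h hN hc; exact ih (k := k + 1) h hN hc
  | later a ih => intro k N h hN hc; exact ih (k := k) h hN hc

variable {ρ : String → Option (GCoTerm Sg)} {J : Set (HBase Sg)}

theorem env_single (k : ℕ) {N : Tm} (hN : N.Cl 0) (t : GCoTerm Sg) (γ : ℕ → GCoTerm Sg) :
    (fun i => val ρ (consEnv t γ) (single (k + 1) N i)) =
      consEnv t (fun i => val ρ γ (single k N i)) := by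
  rw [← ups_single]
  funext i
  cases i with
  | zero => exact val_var (Conv.rfl' _)
  | succ i =>
    change val ρ (consEnv t γ) ((single k N i).ren Nat.succ) = val ρ γ (single k N i)
    rw [Tm.ren_eq_sub, val_sub (single_ok k hN i)]
    congr 1
    funext j
    exact val_var (Conv.rfl' _)

theorem FmV_subst {φ : Fm} : ∀ {K : Set (HBase Sg)} {k : ℕ} {N : Tm} {γ : ℕ → GCoTerm Sg},
    HD Sg φ → N.Cl 0 →
    (FmV ρ J K (φ.subst k N) γ ↔ FmV ρ J K φ (fun i => val ρ γ (single k N i))) := by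
  induction φ with
  | atom p Ms =>
    intro K k N γ h hN
    have : (Ms.map (Tm.subst k N)).map (val ρ γ) =
        Ms.map (val ρ (fun i => val ρ γ (single k N i))) := by
      rw [List.map_map]
      refine List.map_congr_left ?_
      intro M hM
      simp only [Function.comp]
      rw [Tm.subst_eq, val_sub (h M hM)]
    simp only [Fm.subst, FmV, this]
  | top => intros; exact Iff.rfl
  | conj a b iha ihb =>
    intro K k N γ h hN
    exact and_congr (iha h.1 hN) (ihb h.2 hN)
  | impl a b iha ihb =>
    intro K k N γ h hN
    exact imp_congr (iha h.1.hd hN) (ihb h.2 hN)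
  | all τ a ih =>
    intro K k N γ h hN
    refine forall_congr' fun t => ?_
    rw [ih (k := k + 1) h hN, env_single k hN]
  | _ => intro K k N γ h; exact h.elim

theorem FmV_subst_zero {φ : Fm} {K : Set (HBase Sg)} {N : Tm} {γ : ℕ → GCoTerm Sg}
    (h : HD Sg φ) (hN : N.Cl 0) :
    FmV ρ J K (φ.subst 0 N) γ ↔ FmV ρ J K φ (consEnv (val ρ γ N) γ) := by
  rw [FmV_subst h hN]
  have : (fun i => val ρ γ (single 0 N i)) = consEnv (val ρ γ N) γ := by
    rw [single_zero]
    funext i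
    cases i with
    | zero => rfl
    | succ i => exact val_var (Conv.rfl' _)
  rw [this]

theorem FmV_congr {ρ' : String → Option (GCoTerm Sg)} {φ : Fm} :
    ∀ {K : Set (HBase Sg)} {γ : ℕ → GCoTerm Sg}, (∀ c, φ.NoC c ∨ ρ c = ρ' c) →
    (FmV ρ J K φ γ ↔ FmV ρ' J K φ γ) := by
  induction φ with
  | atom p Ms =>
    intro K γ h
    have : Ms.map (val ρ γ) = Ms.map (val ρ' γ) :=
      List.map_congr_left fun M hM => val_congr_const fun c => (h c).imp (fun h => h M hM) id
    simp only [FmV, this]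
  | top => intros; exact Iff.rfl
  | conj a b iha ihb =>
    intro K γ h
    exact and_congr (iha fun c => (h c).imp And.left id) (ihb fun c => (h c).imp And.right id)
  | disj a b iha ihb =>
    intro K γ h
    exact or_congr (iha fun c => (h c).imp And.left id) (ihb fun c => (h c).imp And.right id)
  | impl a b iha ihb =>
    intro K γ h
    exact imp_congr (iha fun c => (h c).imp And.left id) (ihb fun c => (h c).imp And.right id)
  | all τ a ih => intro K γ h; exact forall_congr' fun t => ih h
  | ex τ a ih => intro K γ h; exact exists_congr fun t => ih h
  | later a ih => intro K γ h; exact ih (K := K) (γ := γ) h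

theorem FmV_update {c : String} {t : Option (GCoTerm Sg)} {φ : Fm} {K : Set (HBase Sg)}
    {γ : ℕ → GCoTerm Sg} (h : φ.NoC c) :
    FmV (Function.update ρ c t) J K φ γ ↔ FmV ρ J K φ γ := by
  refine FmV_congr fun d => ?_
  by_cases hd : d = c
  · subst hd; exact Or.inl h
  · right; simp [hd]

/-! ## Soundness of uniform proofs -/

mutual

theorem uni_sound {γ : ℕ → GCoTerm Sg} : ∀ {Sg' : Sig} {P Δ : Set Fm} {G : Fm}
    (_ : Uni Sg' P Δ G) (_ : ∀ D ∈ P ∪ Δ, HD Sg D ∧ FmV ρ J J D γ) (_ : HG Sg G),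
    FmV ρ J J G γ
  | _, _, _, _, .decide hA hD hF, hPD, hG =>
    foc_sound hF hPD (hPD _ hD).1 hA J (hPD _ hD).2
  | _, _, _, _, .topR, _, _ => trivial
  | _, _, _, _, .andR h1 h2, hPD, hG =>
    ⟨uni_sound h1 hPD hG.1, uni_sound h2 hPD hG.2⟩
  | _, _, _, _, .orR1 h1, hPD, hG =>
    hG.elim
  | _, _, _, _, .orR2 h1, hPD, hG =>
    hG.elim
  | _, _, _, _, .implR h1, hPD, hG =>
    hG.elim
  | _, _, _, _, .allR c _ h1, hPD, hG =>
    hG.elim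
  | _, _, _, _, .exR _ h1, hPD, hG =>
    hG.elim

theorem foc_sound {γ : ℕ → GCoTerm Sg} : ∀ {Sg' : Sig} {P Δ : Set Fm} {D A : Fm}
    (_ : Foc Sg' P Δ D A) (_ : ∀ D ∈ P ∪ Δ, HD Sg D ∧ FmV ρ J J D γ) (_ : HD Sg D)
    (_ : A.Atomic) (K : Set (HBase Sg)) (_ : FmV ρ J K D γ), FmV ρ J K A γ
  | _, _, _, _, _, .init hc, hPD, hD, hA, K, hK => by
    rcases hA with rfl | ⟨p, Ms, rfl⟩
    · trivial
    · cases hc with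
      | atom hc =>
        have : ∀ {Ms Ns : List Tm}, List.Forall₂ Conv Ms Ns →
            Ms.map (val ρ γ) = Ns.map (val ρ γ) := by
          intro Ms Ns h
          induction h with
          | nil => rfl
          | cons h _ ih => simp only [List.map_cons, ih, val_conv h]
        simp only [FmV] at hK ⊢
        rw [this hc]; exact hK
  | _, _, _, _, _, .implL h1 h2, hPD, hD, hA, K, hK =>
    foc_sound h1 hPD hD.2 hA K (hK (uni_sound h2 hPD hD.1))
  | _, _, _, _, _, .andL1 h1, hPD, hD, hA, K, hK =>
    foc_sound h1 hPD hD.1 hA K hK.1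
  | _, _, _, _, _, .andL2 h1, hPD, hD, hA, K, hK =>
    foc_sound h1 hPD hD.2 hA K hK.2
  | _, _, _, .all _ D, _, .allL hN h1, hPD, hD, hA, K, hK =>
    have hD' : HD Sg D := hD
    foc_sound h1 hPD (hD'.subst hN.cl) hA K ((FmV_subst_zero hD' hN.cl).2 (hK _))

end

theorem gua_sound {γ : ℕ → GCoTerm Sg} {K : Set (HBase Sg)} {Sg' : Sig} {P Δ : Set Fm} {φ : Fm}
    (h : Gua Sg' P Δ φ) : ∀ {ρ : String → Option (GCoTerm Sg)},
    (∀ c, Sg' c = none → Sg c = none) →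
    (∀ D ∈ P, HD Sg D ∧ ∀ ρ : String → Option (GCoTerm Sg), (∀ c, Sg c ≠ none → ρ c = none) →
      FmV ρ J J D γ ∧ FmV ρ J K D γ) →
    (∀ c, Sg c ≠ none → ρ c = none) →
    (∀ D ∈ Δ, HD Sg D ∧ FmV ρ J J D γ ∧ ∀ c, Sg' c = none → D.NoC c) →
    HD Sg φ → (∀ c, Sg' c = none → φ.NoC c) → FmV ρ J K φ γ := by
  induction h with
  | decideG hA hD hF =>
    intro ρ h1 hP hρ hΔ hφ hc
    refine foc_sound hF ?_ (hP _ hD).1 hA K ((hP _ hD).2 ρ hρ).2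
    rintro D (h | h)
    · exact ⟨(hP D h).1, ((hP D h).2 ρ hρ).1⟩
    · exact ⟨(hΔ D h).1, (hΔ D h).2.1⟩
  | @allRG Sg' P Δ τ φ c hcn _ ih =>
    intro ρ h1 hP hρ hΔ hφ hc t
    change HD Sg φ at hφ
    change ∀ c, Sg' c = none → φ.NoC c at hc
    have hsub : ∀ d, Function.update Sg' c (some τ) d = none → d ≠ c ∧ Sg' d = none := by
      intro d hd
      by_cases hdc : d = c
      · subst hdc; simp at hd
      · refine ⟨hdc, ?_⟩
        rwa [Function.update_of_ne hdc] at hd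
    have hcl : (Tm.const c).Cl 0 := trivial
    have key := ih (ρ := Function.update ρ c (some t)) (fun d hd => h1 d (hsub d hd).2) hP
      (by
        intro d hd
        have : d ≠ c := by rintro rfl; exact hd (h1 _ hcn)
        rw [Function.update_of_ne this]; exact hρ d hd)
      (fun D hD => ⟨(hΔ D hD).1, (FmV_update ((hΔ D hD).2.2 c hcn)).2 (hΔ D hD).2.1,
        fun d hd => (hΔ D hD).2.2 d (hsub d hd).2⟩)
      (HD.subst hφ hcl)
      (fun d hd => Fm.NoC.subst (hc d (hsub d hd).2) hcl (fun h => (hsub d hd).1 h.symm))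
    rw [FmV_subst_zero hφ hcl] at key
    have hv : val (Function.update ρ c (some t)) γ (.const c) = t :=
      val_const (Ns := []) (Conv.rfl' _) (by simp)
    rw [hv] at key
    exact (FmV_update (hc c hcn)).1 key
  | andRG _ _ ih1 ih2 =>
    intro ρ h1 hP hρ hΔ hφ hc
    exact ⟨ih1 h1 hP hρ hΔ hφ.1 (fun c h => (hc c h).1),
      ih2 h1 hP hρ hΔ hφ.2 (fun c h => (hc c h).2)⟩
  | implRG _ ih =>
    intro ρ h1 hP hρ hΔ hφ hc hφ1
    refine ih h1 hP hρ ?_ hφ.2 (fun c h => (hc c h).2)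
    rintro D (rfl | h)
    · exact ⟨hφ.1.hd, hφ1, fun c h => (hc c h).1⟩
    · exact hΔ D h

/-! ## Clauses -/

theorem consEnv_eta (γ : ℕ → GCoTerm Sg) : consEnv (γ 0) (fun i => γ (i + 1)) = γ := by
  funext i; cases i <;> rfl

theorem FmV_mkAll {K : Set (HBase Sg)} (n : ℕ) (φ : Fm) :
    (∀ γ, FmV ρ J K (mkAll n φ) γ) ↔ ∀ γ, FmV ρ J K φ γ := by
  induction n with
  | zero => exact Iff.rfl
  | succ n ih =>
    rw [← ih]
    constructor
    · intro h γ
      have := h (fun i => γ (i + 1)) (γ 0)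
      rwa [consEnv_eta] at this
    · intro h γ t; exact h _

theorem FmV_mkConj {K : Set (HBase Sg)} {γ : ℕ → GCoTerm Sg} : ∀ (l : List Fm),
    FmV ρ J K (mkConj l) γ ↔ ∀ A ∈ l, FmV ρ J K A γ
  | [] => by simp [mkConj, FmV]
  | [A] => by simp [mkConj]
  | A :: B :: l => by
    have := FmV_mkConj (K := K) (γ := γ) (B :: l)
    rw [mkConj, FmV, this]
    · simp
    · simp

theorem HG_mkConj : ∀ (l : List Fm), (∀ A ∈ l, HG Sg A) → HG Sg (mkConj l)
  | [], _ => trivial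
  | [A], h => h A (by simp)
  | A :: B :: l, h => ⟨h A (by simp), HG_mkConj (B :: l) (fun A hA => h A (by simp [hA]))⟩

theorem NoC_mkConj {c : String} : ∀ (l : List Fm), (∀ A ∈ l, A.NoC c) → (mkConj l).NoC c
  | [], _ => trivial
  | [A], h => h A (by simp)
  | A :: B :: l, h => ⟨h A (by simp), NoC_mkConj (B :: l) (fun A hA => h A (by simp [hA]))⟩

theorem Atm.WFg.gt {Pg : PSig} {n : ℕ} {A : Atm} (h : A.WFg Sg Pg n) :
    ∀ M ∈ A.args, GT Sg n M := by
  obtain ⟨τs, h0, h1, h2⟩ := h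
  clear h0
  intro M hM
  generalize A.args = Ms at h2 hM
  induction h2 with
  | nil => simp at hM
  | @cons a b l1 l2 h _ ih =>
    rcases List.mem_cons.1 hM with rfl | hM
    · have := h1 b (by simp)
      subst this
      exact h
    · exact ih (fun τ hτ => h1 τ (by simp [hτ])) hM

theorem HClause.hd (hSg : Sg.FirstOrder) {Pg : PSig} {C : HClause} (h : C.WFg Sg Pg) :
    HD Sg C.toFm := by
  have : ∀ (n : ℕ) (φ : Fm), HD Sg φ → HD Sg (mkAll n φ) := by
    intro n φ h
    induction n with
    | zero => exact h
    | succ n ih => exact ih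
  refine this _ _ ⟨HG_mkConj _ ?_, fun M hM => (h.1.gt M hM).ok hSg⟩
  intro A hA
  obtain ⟨B, hB, rfl⟩ := List.mem_map.1 hA
  exact fun M hM => ((h.2 B hB).gt M hM).ok hSg

theorem HClause.noC {Pg : PSig} {C : HClause} (h : C.WFg Sg Pg) {c : String}
    (hc : Sg c = none) : C.toFm.NoC c := by
  have : ∀ (n : ℕ) (φ : Fm), φ.NoC c → (mkAll n φ).NoC c := by
    intro n φ h
    induction n with
    | zero => exact h
    | succ n ih => exact ih
  refine this _ _ ⟨NoC_mkConj _ ?_, fun M hM => (h.1.gt M hM).2.noC hc⟩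
  intro A hA
  obtain ⟨B, hB, rfl⟩ := List.mem_map.1 hA
  exact fun M hM => ((h.2 B hB).gt M hM).2.noC hc

theorem Atm.FmV_iff (hSg : Sg.FirstOrder) {sem : Tm → CoTerm Sg ℕ} (hsem : SemSpec Sg sem)
    {Pg : PSig} {n : ℕ} {A : Atm} (h : A.WFg Sg Pg n) (hρ : ∀ c, Sg c ≠ none → ρ c = none)
    {K : Set (HBase Sg)} {γ : ℕ → GCoTerm Sg} :
    FmV ρ J K A.toFm γ ↔ A.gsem sem γ ∈ K := by
  have : A.args.map (val ρ γ) = A.args.map fun M => csubst (sem M) γ :=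
    List.map_congr_left fun M hM => (h.gt M hM).val_eq hSg hsem hρ γ
  simp only [Atm.toFm, FmV, Atm.gsem, this]

theorem HClause.FmV_iff (hSg : Sg.FirstOrder) {sem : Tm → CoTerm Sg ℕ} (hsem : SemSpec Sg sem)
    {Pg : PSig} {C : HClause} (h : C.WFg Sg Pg) (hρ : ∀ c, Sg c ≠ none → ρ c = none)
    {K : Set (HBase Sg)} :
    (∀ γ, FmV ρ J K C.toFm γ) ↔
      ∀ θ, (∀ B ∈ C.body, B.gsem sem θ ∈ J) → C.head.gsem sem θ ∈ K := by
  unfold HClause.toFm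
  rw [FmV_mkAll]
  refine forall_congr' fun θ => ?_
  simp only [FmV]
  rw [FmV_mkConj, Atm.FmV_iff hSg hsem h.1 hρ]
  refine imp_congr_left ?_
  simp only [List.forall_mem_map]
  exact forall₂_congr fun B hB => Atm.FmV_iff hSg hsem (h.2 B hB) hρ

theorem FmSemI_mkAll (sem : Tm → CoTerm Sg ℕ) (I : Set (HBase Sg)) (n : ℕ) (φ : Fm)
    (h : ∀ γ, γ ∈ FmSemI sem I φ) : ∀ γ, γ ∈ FmSemI sem I (mkAll n φ) := by
  induction n with
  | zero => exact h
  | succ n ih => intro γ t; exact ih _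

theorem FmSemI_mkConj {sem : Tm → CoTerm Sg ℕ} {I : Set (HBase Sg)} {γ : ℕ → GCoTerm Sg} :
    ∀ (l : List Fm), γ ∈ FmSemI sem I (mkConj l) → ∀ A ∈ l, γ ∈ FmSemI sem I A
  | [], _ => by simp
  | [A], h => by simpa [mkConj] using h
  | A :: B :: l, h => by
    intro C hC
    rcases List.mem_cons.1 hC with rfl | hC
    · exact h.1
    · exact FmSemI_mkConj (B :: l) h.2 C hC

/-- The least interpretation above the Herbrand model closed under `P` and `C`. -/
inductive JSet (P : Set HClause) (sem : Tm → CoTerm Sg ℕ) (C : HClause) : HBase Sg → Prop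
  | model {a} : a ∈ HModel P sem → JSet P sem C a
  | prog {D θ} : D ∈ P → (∀ B ∈ D.body, JSet P sem C (B.gsem sem θ)) →
      JSet P sem C (D.head.gsem sem θ)
  | hyp {θ} : (∀ B ∈ C.body, JSet P sem C (B.gsem sem θ)) → JSet P sem C (C.head.gsem sem θ)

end FmSemantics
/-- **Soundness of coinductive uniform proofs for complete Herbrand models**:
if `φ` is an `H^g`-formula and `Σ; P ⊢co φ` is provable in CUP, then the
interpretation of `φ` in the complete Herbrand model `M(P)` is the true
predicate, `⟦φ⟧_{M(P)} = ⊤`. -/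
theorem cup_soundness_herbrand (Sg : Sig) (Pg : PSig) (hSg : Sg.FirstOrder)
    (sem : Tm → CoTerm Sg ℕ) (hsem : SemSpec Sg sem)
    (P : Set HClause) (hP : ∀ C ∈ P, C.WFg Sg Pg)
    (C : HClause) (hC : C.WFg Sg Pg)
    (h : CUP Sg (HClause.toFm '' P) C.toFm) :
    FmSemI sem (HModel P sem) C.toFm = Set.univ := by
  set J : Set (HBase Sg) := {a | JSet P sem C a} with hJ
  set K : Set (HBase Sg) := PhiP P sem J with hK
  have hMJ : HModel P sem ⊆ J := fun a ha => JSet.model ha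
  have hfix : PhiP P sem (HModel P sem) = HModel P sem :=
    OrderHom.map_gfp ⟨PhiP P sem, PhiP_mono P sem⟩
  have hprog : ∀ D ∈ HClause.toFm '' P, HD Sg D ∧
      ∀ ρ : String → Option (GCoTerm Sg), (∀ c, Sg c ≠ none → ρ c = none) →
      ∀ γ, FmV ρ J J D γ ∧ FmV ρ J K D γ := by
    rintro _ ⟨D, hD, rfl⟩
    refine ⟨HClause.hd hSg (hP D hD), fun ρ hρ γ => ⟨?_, ?_⟩⟩
    · exact (HClause.FmV_iff hSg hsem (hP D hD) hρ).2 (fun θ hb => JSet.prog hD hb) γ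
    · exact (HClause.FmV_iff (K := K) hSg hsem (hP D hD) hρ).2 (fun θ hb => ⟨D, hD, θ, rfl, hb⟩) γ
  have hCK : ∀ γ, FmV (fun _ => none) J K C.toFm γ := by
    intro γ
    refine gua_sound h (fun c hc => hc)
      (fun D hD => ⟨(hprog D hD).1, fun ρ hρ => (hprog D hD).2 ρ hρ γ⟩) (fun _ _ => rfl) ?_
      (HClause.hd hSg hC) (fun c hc => HClause.noC hC hc)
    rintro D rfl
    exact ⟨HClause.hd hSg hC, (HClause.FmV_iff hSg hsem hC (fun _ _ => rfl)).2
      (fun θ hb => JSet.hyp hb) γ, fun c hc => HClause.noC hC hc⟩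
  have hCK2 := (HClause.FmV_iff hSg hsem hC (fun _ _ => rfl)).1 hCK
  have hJK : J ⊆ K := by
    intro a ha
    cases ha with
    | model hm =>
      rw [← hfix] at hm
      exact PhiP_mono P sem hMJ hm
    | prog hD hb => exact ⟨_, hD, _, rfl, hb⟩
    | hyp hb => exact hCK2 _ hb
  have hJM : J ⊆ HModel P sem := OrderHom.le_gfp ⟨PhiP P sem, PhiP_mono P sem⟩ hJK
  refine Set.eq_univ_of_forall (FmSemI_mkAll sem _ _ _ ?_)
  intro γ hb
  refine hJM (JSet.hyp ?_)
  intro B hB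
  exact hMJ (FmSemI_mkConj _ hb B.toFm (List.mem_map_of_mem hB))
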